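/- arXiv:1711.02983 — 3 statements merged into one kernel-verified Lean document; each statement's English description precedes it below -/
import Mathlib

section
/- Let K₁ and K₂ be imaginary quadratic number fields whose discriminants are coprime. Then for every pair of ideal classes C₁ ∈ Cl(K₁) and C₂ ∈ Cl(K₂) there exist nonzero integral ideals 𝔞₁ ⊆ 𝒪_{K₁} and 𝔞₂ ⊆ 𝒪_{K₂} representing C₁ and C₂ respectively, such that the absolute norms of 𝔞₁ and 𝔞₂ are equal. -/
open NumberField
open scoped nonZeroDivisors
open scoped NumberTheorySymbols

/-- The ring of integers of a quadratic field has an integral basis starting with `1`. -/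
theorem exists_basis_zero_eq_one {K : Type*} [Field K] [NumberField K]
    (hdeg : Module.finrank ℚ K = 2) :
    ∃ b : Module.Basis (Fin 2) ℤ (𝓞 K), b 0 = 1 := by
  have hrank : Module.finrank ℤ (𝓞 K) = 2 := by rw [RingOfIntegers.rank, hdeg]
  let b := Module.finBasisOfFinrankEq ℤ (𝓞 K) hrank
  obtain ⟨c₀, c₁, hc⟩ : ∃ c₀ c₁ : ℤ, (1 : 𝓞 K) = c₀ • b 0 + c₁ • b 1 :=
    ⟨b.repr 1 0, b.repr 1 1, by rw [← Fin.sum_univ_two (fun i => b.repr 1 i • b i), b.sum_repr]⟩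
  have hcop : IsCoprime c₀ c₁ := by
    rw [Int.isCoprime_iff_gcd_eq_one]
    obtain ⟨e₀, he₀⟩ := Int.gcd_dvd_left c₀ c₁
    obtain ⟨e₁, he₁⟩ := Int.gcd_dvd_right c₀ c₁
    set g := Int.gcd c₀ c₁
    have h1 : (1 : 𝓞 K) = (g : 𝓞 K) * (e₀ • b 0 + e₁ • b 1) := by
      rw [hc, he₀, he₁]
      simp only [zsmul_eq_mul]
      push_cast
      ring
    have h2 := congrArg (Algebra.norm ℤ) h1
    rw [map_one, map_mul, show (g : 𝓞 K) = algebraMap ℤ (𝓞 K) (g : ℤ) by simp,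
      Algebra.norm_algebraMap_of_basis b, Fintype.card_fin] at h2
    have h3 : (g : ℤ) ∣ 1 := by
      rw [h2]
      exact Dvd.dvd.mul_right (dvd_pow_self _ two_ne_zero) _
    exact Nat.dvd_one.mp (by exact_mod_cast h3)
  obtain ⟨u₁, u₀, hu⟩ := hcop
  let ω : 𝓞 K := u₁ • b 1 - u₀ • b 0
  let v : Fin 2 → 𝓞 K := ![1, ω]
  have hspan : ⊤ ≤ Submodule.span ℤ (Set.range v) := by
    rw [← b.span_eq, Submodule.span_le]
    have huR : (u₁ : 𝓞 K) * c₀ + u₀ * c₁ = 1 := by exact_mod_cast congrArg (Int.cast : ℤ → 𝓞 K) hu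
    rintro _ ⟨i, rfl⟩
    have h0 : (1 : 𝓞 K) ∈ Submodule.span ℤ (Set.range v) := Submodule.subset_span ⟨0, rfl⟩
    have h1 : ω ∈ Submodule.span ℤ (Set.range v) := Submodule.subset_span ⟨1, rfl⟩
    fin_cases i
    · have : b 0 = u₁ • (1 : 𝓞 K) - c₁ • ω := by
        rw [hc]
        simp only [ω, zsmul_eq_mul]
        linear_combination (-b 0) * huR
      change b 0 ∈ _
      rw [this]
      exact sub_mem (Submodule.smul_mem _ _ h0) (Submodule.smul_mem _ _ h1)
    · have : b 1 = u₀ • (1 : 𝓞 K) + c₀ • ω := by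
        rw [hc]
        simp only [ω, zsmul_eq_mul]
        linear_combination (-b 1) * huR
      change b 1 ∈ _
      rw [this]
      exact add_mem (Submodule.smul_mem _ _ h0) (Submodule.smul_mem _ _ h1)
  exact ⟨basisOfTopLeSpanOfCardEqFinrank v hspan (by simp [hrank]), by simp [v]⟩

/-- A quadratic field contains an integral square root `δ` of its discriminant, which is
`0` or `1` modulo `4`. -/
theorem exists_sq_eq_discr {K : Type*} [Field K] [NumberField K]
    (hdeg : Module.finrank ℚ K = 2) :
    ∃ (t n : ℤ) (δ : 𝓞 K), discr K = t ^ 2 - 4 * n ∧ δ ^ 2 = (discr K : 𝓞 K) ∧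
      ∀ x y : ℤ, Algebra.norm ℤ ((x : 𝓞 K) + y * δ) = x ^ 2 - discr K * y ^ 2 := by
  obtain ⟨b, hb⟩ := exists_basis_zero_eq_one hdeg
  set ω := b 1 with hω
  obtain ⟨n, t, hsq⟩ : ∃ n t : ℤ, ω ^ 2 = t • ω - n • (1 : 𝓞 K) := by
    refine ⟨-b.repr (ω ^ 2) 0, b.repr (ω ^ 2) 1, ?_⟩
    conv_lhs => rw [← b.sum_repr (ω ^ 2), Fin.sum_univ_two, hb]
    rw [neg_smul, sub_neg_eq_add, add_comm]
  have hmat (x y : ℤ) : Algebra.leftMulMatrix b ((x : 𝓞 K) + y * ω) =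
      !![x, -n * y; y, x + t * y] := by
    have h0 : ((x : 𝓞 K) + y * ω) * b 0 = x • b 0 + y • b 1 := by
      simp [hb, ← hω]
    have h1 : ((x : 𝓞 K) + y * ω) * b 1 = (-n * y) • b 0 + (x + t * y) • b 1 := by
      rw [← hω, hb]
      simp only [zsmul_eq_mul] at hsq ⊢
      push_cast
      linear_combination (y : 𝓞 K) * hsq
    ext i j
    rw [Algebra.leftMulMatrix_eq_repr_mul]
    fin_cases j
    · rw [Fin.zero_eta, h0, map_add, map_smul, map_smul]
      fin_cases i <;> simp
    · rw [Fin.mk_one, h1, map_add, map_smul, map_smul]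
      fin_cases i <;> simp
  have hnorm (x y : ℤ) : Algebra.norm ℤ ((x : 𝓞 K) + y * ω) = x ^ 2 + t * x * y + n * y ^ 2 := by
    rw [Algebra.norm_eq_matrix_det b, hmat, Matrix.det_fin_two_of]
    ring
  have htr (x y : ℤ) : Algebra.trace ℤ (𝓞 K) ((x : 𝓞 K) + y * ω) = 2 * x + t * y := by
    rw [Algebra.trace_eq_matrix_trace b, hmat, Matrix.trace_fin_two_of]
    ring
  have hdiscr : discr K = t ^ 2 - 4 * n := by
    rw [← discr_eq_discr K b, Algebra.discr_def, Matrix.det_fin_two]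
    simp only [Algebra.traceMatrix_apply, Algebra.traceForm_apply, hb, ← hω]
    have e0 := htr 1 0
    have e1 := htr 0 1
    have e2 := htr (-n) t
    have h2 : ω * ω = ((-n : ℤ) : 𝓞 K) + t * ω := by
      simp only [zsmul_eq_mul] at hsq
      push_cast
      linear_combination hsq
    rw [← h2] at e2
    simp only [Int.cast_one, Int.cast_zero, zero_mul, add_zero, one_mul, zero_add] at e0 e1
    simp only [one_mul, mul_one, e0, e1, e2]
    ring
  refine ⟨t, n, 2 * ω - t, hdiscr, ?_, fun x y => ?_⟩
  · simp only [zsmul_eq_mul] at hsq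
    rw [hdiscr]
    push_cast
    linear_combination 4 * hsq
  · have := hnorm (x - t * y) (2 * y)
    rw [hdiscr, show (x : 𝓞 K) + y * (2 * ω - t) = ((x - t * y : ℤ) : 𝓞 K) + (2 * y : ℤ) * ω by
      push_cast; ring, this]
    ring

theorem discr_neg_of_not_isReal {K : Type*} [Field K] [NumberField K]
    (hdeg : Module.finrank ℚ K = 2)
    (himag : ∀ φ : K →+* ℂ, ¬ ComplexEmbedding.IsReal φ) : discr K < 0 := by
  have : IsTotallyComplex K := ⟨fun v => by
    rw [← InfinitePlace.not_isReal_iff_isComplex, InfinitePlace.isReal_iff]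
    exact himag _⟩
  have h := IsTotallyComplex.finrank K
  have hr : InfinitePlace.nrComplexPlaces K = 1 := by omega
  have hs := sign_discr K
  rw [hr, pow_one] at hs
  exact Int.sign_eq_neg_one_iff_neg.mp hs

/-- The ceiling of `√k`. -/
theorem exists_sqrt_bound {k : ℕ} (hk : k ≠ 0) : ∃ a : ℕ, k ≤ a ^ 2 ∧ ∀ i < a, i ^ 2 < k := by
  refine ⟨Nat.sqrt (k - 1) + 1, ?_, fun i hi => ?_⟩
  · have := Nat.lt_succ_sqrt' (k - 1)
    rw [Nat.succ_eq_add_one] at this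
    omega
  · have h1 := Nat.pow_le_pow_left (Nat.lt_succ_iff.mp hi) 2
    have h2 := Nat.sqrt_le' (k - 1)
    omega

/-- A pigeonhole argument producing a short vector in the kernel of a homomorphism from `ℤ³`. -/
theorem exists_short_vector_map_eq_zero {A : Type*} [AddCommGroup A] [Finite A] {D m : ℕ}
    (hD : D ≠ 0) (hm : ¬ IsSquare m) (hA : Nat.card A ≤ D * m) (f : ℤ × ℤ × ℤ →+ A) :
    ∃ x y z : ℤ, (x, y, z) ≠ 0 ∧ f (x, y, z) = 0 ∧ x ^ 2 < D * m ∧ y ^ 2 < m ∧ z ^ 2 < D := by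
  have hm0 : m ≠ 0 := by rintro rfl; exact hm IsSquare.zero
  obtain ⟨a, ha, ha'⟩ := exists_sqrt_bound (mul_ne_zero hD hm0)
  obtain ⟨b, hb, hb'⟩ := exists_sqrt_bound hm0
  obtain ⟨c, hc, hc'⟩ := exists_sqrt_bound hD
  have hb2 : m < b ^ 2 := lt_of_le_of_ne hb fun h => hm ⟨b, by rw [h, sq]⟩
  have hcard : D * m < a * (b * c) := by
    refine lt_of_pow_lt_pow_left₀ 2 (Nat.zero_le _) ?_
    calc (D * m) ^ 2 = (D * m) * (m * D) := by ring
      _ < (D * m) * (b ^ 2 * D) := by gcongr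
      _ ≤ a ^ 2 * (b ^ 2 * c ^ 2) := by gcongr
      _ = (a * (b * c)) ^ 2 := by ring
  have := Fintype.ofFinite A
  let g : Fin a × Fin b × Fin c → A := fun v => f ((v.1 : ℕ), (v.2.1 : ℕ), (v.2.2 : ℕ))
  obtain ⟨v, w, hvw, hg⟩ := Fintype.exists_ne_map_eq_of_card_lt g (by
    rw [← Nat.card_eq_fintype_card]
    simpa using hA.trans_lt hcard)
  have key {k N : ℕ} (hk : ∀ i < k, i ^ 2 < N) (i j : Fin k) :
      (((i : ℕ) : ℤ) - ((j : ℕ) : ℤ)) ^ 2 < N := by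
    have h1 := hk i i.2
    have h2 := hk j j.2
    have h3 : (((i : ℕ) : ℤ)) ^ 2 < N := by exact_mod_cast h1
    have h4 : (((j : ℕ) : ℤ)) ^ 2 < N := by exact_mod_cast h2
    have h5 : (0 : ℤ) ≤ (i : ℕ) := by positivity
    have h6 : (0 : ℤ) ≤ (j : ℕ) := by positivity
    rcases le_total ((i : ℕ) : ℤ) ((j : ℕ) : ℤ) with h | h <;> nlinarith
  refine ⟨(v.1 : ℕ) - (w.1 : ℕ), (v.2.1 : ℕ) - (w.2.1 : ℕ), (v.2.2 : ℕ) - (w.2.2 : ℕ), ?_, ?_,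
    by exact_mod_cast key ha' v.1 w.1, key hb' v.2.1 w.2.1, key hc' v.2.2 w.2.2⟩
  · intro h
    simp only [Prod.ext_iff, Prod.fst_zero, Prod.snd_zero, sub_eq_zero, Nat.cast_inj,
      Fin.val_inj] at h
    exact hvw (Prod.ext h.1 (Prod.ext h.2.1 h.2.2))
  · have h : f (((v.1 : ℕ) : ℤ), ((v.2.1 : ℕ) : ℤ), ((v.2.2 : ℕ) : ℤ)) -
        f (((w.1 : ℕ) : ℤ), ((w.2.1 : ℕ) : ℤ), ((w.2.2 : ℕ) : ℤ)) = 0 := sub_eq_zero.mpr hg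
    rwa [← map_sub] at h

/-- If `𝔞` has norm `n`, and `p` is a prime congruent to `n` modulo `d` such that `d` is a square
modulo `p`, then `p * n` times a nonzero square is the norm of an element. -/
theorem exists_norm_eq_mul_sq {S : Type*} [CommRing S] [IsDedekindDomain S]
    [Module.Free ℤ S] [Module.Finite ℤ S] {d : ℤ} (hd : d < 0) {δ : S}
    (hnorm : ∀ x y : ℤ, Algebra.norm ℤ ((x : S) + y * δ) = x ^ 2 - d * y ^ 2)
    {𝔞 : Ideal S} (h𝔞 : Ideal.absNorm 𝔞 ≠ 0) (hcop : (Ideal.absNorm 𝔞).Coprime d.natAbs)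
    {p : ℕ} (hp : p.Prime) (hpn : ¬ p ∣ Ideal.absNorm 𝔞)
    (hpd : (p : ZMod d.natAbs) = Ideal.absNorm 𝔞) (hsq : IsSquare (d : ZMod p)) :
    ∃ (α : S) (w : ℕ), w ≠ 0 ∧ Algebra.norm ℤ α = p * Ideal.absNorm 𝔞 * w ^ 2 := by
  set n := Ideal.absNorm 𝔞 with hn
  set D := d.natAbs with hDdef
  have hdD : d = -D := by omega
  have hD0 : D ≠ 0 := by omega
  have : NeZero D := ⟨hD0⟩
  have : NeZero p := ⟨hp.ne_zero⟩
  have hpncop : p.Coprime n := (Nat.Prime.coprime_iff_not_dvd hp).mpr hpn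
  have hpD : p.Coprime D := by
    rw [← ZMod.isUnit_iff_coprime, hpd, ZMod.isUnit_iff_coprime]
    exact hcop
  have hmsq : ¬ IsSquare (p * n) := by
    rintro ⟨k, hk⟩
    have h1 : p ∣ k := by
      have : p ∣ k * k := ⟨n, hk.symm⟩
      exact (hp.dvd_mul.mp this).elim id id
    obtain ⟨l, rfl⟩ := h1
    have h2 : n = p * (l * l) := by
      apply Nat.eq_of_mul_eq_mul_left hp.pos
      rw [hk]; ring
    exact hpn ⟨_, h2⟩
  obtain ⟨r, hr⟩ := hsq
  have : Finite (S ⧸ 𝔞) := (Ideal.absNorm_ne_zero_iff 𝔞).mp h𝔞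
  let f : ℤ × ℤ × ℤ →+ (S ⧸ 𝔞) × ZMod p × ZMod D := AddMonoidHom.mk'
    (fun v => (Ideal.Quotient.mk 𝔞 ((v.1 : S) + v.2.1 * δ), (v.1 : ZMod p) - r * v.2.1,
      (v.1 : ZMod D) - n * v.2.2)) (fun v w => by
        ext
        · simp only [Prod.fst_add, Prod.snd_add, ← map_add]
          congr 1
          push_cast
          ring
        · simp only [Prod.fst_add, Prod.snd_add]
          push_cast
          ring
        · simp only [Prod.fst_add, Prod.snd_add]
          push_cast
          ring)
  obtain ⟨x, y, z, hne, hf, hx, hy, hz⟩ :=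
    exists_short_vector_map_eq_zero (D := D) (m := p * n) hD0 hmsq (by
      rw [Nat.card_prod, Nat.card_prod, Nat.card_zmod, Nat.card_zmod]
      change n * (p * D) ≤ _
      exact le_of_eq (by ring)) f
  obtain ⟨hf1, hf2, hf3⟩ : (Ideal.Quotient.mk 𝔞 ((x : S) + y * δ) = 0) ∧
      ((x : ZMod p) - r * y = 0) ∧ ((x : ZMod D) - n * z = 0) := by
    simpa only [f, AddMonoidHom.mk'_apply, Prod.ext_iff, Prod.fst_zero, Prod.snd_zero] using hf
  have hdvdn : (n : ℤ) ∣ x ^ 2 - d * y ^ 2 := by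
    rw [← hnorm]
    exact Ideal.absNorm_dvd_norm_of_mem (Ideal.Quotient.eq_zero_iff_mem.mp hf1)
  have hdvdp : (p : ℤ) ∣ x ^ 2 - d * y ^ 2 := by
    rw [← ZMod.intCast_zmod_eq_zero_iff_dvd]
    push_cast
    rw [hr]
    linear_combination (x + r * y) * hf2
  have hdvdD : (D : ℤ) ∣ x ^ 2 - p * n * z ^ 2 := by
    rw [← ZMod.intCast_zmod_eq_zero_iff_dvd]
    push_cast
    rw [hpd]
    linear_combination (x + n * z) * hf3
  have hdvd : ((D : ℤ) * (p * n)) ∣ x ^ 2 + D * y ^ 2 - p * n * z ^ 2 := by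
    refine IsCoprime.mul_dvd ?_ ?_ ?_
    · exact_mod_cast Nat.isCoprime_iff_coprime.mpr (Nat.Coprime.mul_right hpD.symm hcop.symm)
    · have : x ^ 2 + D * y ^ 2 - p * n * z ^ 2 = (x ^ 2 - p * n * z ^ 2) + D * y ^ 2 := by ring
      rw [this]
      exact dvd_add hdvdD (dvd_mul_right _ _)
    · refine dvd_sub ?_ (dvd_mul_right _ _)
      have := IsCoprime.mul_dvd (Nat.isCoprime_iff_coprime.mpr hpncop) hdvdp hdvdn
      rwa [hdD, neg_mul, sub_neg_eq_add] at this
  obtain ⟨k, hk⟩ := hdvd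
  have hm0 : (0 : ℤ) < p * n := by
    exact_mod_cast Nat.mul_pos hp.pos (Nat.pos_of_ne_zero h𝔞)
  have hDp : (0 : ℤ) < D := by exact_mod_cast Nat.pos_of_ne_zero hD0
  push_cast at hx hy
  have hk1 : k < 2 := by
    by_contra! h
    nlinarith [mul_pos hDp hm0, mul_nonneg hm0.le (sq_nonneg z), mul_lt_mul_of_pos_left hy hDp,
      mul_le_mul_of_nonneg_left h (mul_pos hDp hm0).le]
  have hk0 : -1 < k := by
    by_contra! h
    nlinarith [mul_pos hDp hm0, sq_nonneg x, mul_nonneg hDp.le (sq_nonneg y),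
      mul_lt_mul_of_pos_left hz hm0, mul_le_mul_of_nonneg_left h (mul_pos hDp hm0).le]
  obtain rfl | rfl : k = 0 ∨ k = 1 := by omega
  · refine ⟨(x : S) + y * δ, z.natAbs, fun h => hne ?_, ?_⟩
    · rw [Int.natAbs_eq_zero] at h
      subst h
      have h2 := mul_nonneg hDp.le (sq_nonneg y)
      have hx0 : x ^ 2 = 0 := by nlinarith [sq_nonneg x]
      have hy0 : (D : ℤ) * y ^ 2 = 0 := by nlinarith
      have hy0' : y = 0 := by simpa [hD0] using hy0
      have hx0' : x = 0 := by simpa using hx0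
      simp [hx0', hy0']
    · rw [hnorm, Int.natAbs_sq, hdD]
      linear_combination hk
  · refine ⟨((x : S) + y * δ) * ((z : S) + (1 : ℤ) * δ), (z ^ 2 - d).natAbs, ?_, ?_⟩
    · rw [Int.natAbs_ne_zero]
      nlinarith [sq_nonneg z]
    · rw [map_mul, hnorm, hnorm, Int.natAbs_sq, hdD]
      linear_combination (z ^ 2 + (D : ℤ)) * hk

theorem jacobiSym_absNorm_eq_one {S : Type*} [CommRing S] [IsDedekindDomain S]
    [Module.Free ℤ S] [Module.Finite ℤ S] (hrank : Module.finrank ℤ S = 2) {d : ℤ} {δ : S}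
    (hδ : δ ^ 2 = (d : S)) (I : Ideal S) (hI : (Ideal.absNorm I).Coprime d.natAbs) :
    J(d | Ideal.absNorm I) = 1 := by
  induction I using UniqueFactorizationMonoid.induction_on_prime with
  | h₁ => simp
  | h₂ I hI' =>
    obtain rfl : I = ⊤ := by simpa using hI'
    simp
  | h₃ I P hI' hP IH =>
    rw [map_mul] at hI ⊢
    have hPcop := Nat.Coprime.coprime_mul_right hI
    have hgcd : d.gcd (Ideal.absNorm P) = 1 := by
      rw [Int.gcd_def, Int.natAbs_natCast]
      exact hPcop.symm
    have := Ideal.isPrime_of_prime hP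
    have hmax := this.isMaximal hP.ne_zero
    have hI0 : Ideal.absNorm I ≠ 0 := fun h => hI' (Ideal.absNorm_eq_zero_iff.mp h)
    have hP0 : Ideal.absNorm P ≠ 0 := fun h => hP.ne_zero (Ideal.absNorm_eq_zero_iff.mp h)
    rw [jacobiSym.mul_right' _ hP0 hI0, IH (Nat.Coprime.coprime_mul_left hI), mul_one]
    obtain ⟨ℓ, f, hf, hℓP, hℓ, hN⟩ := Ideal.exists_prime_and_absNorm_eq_pow P
    have hf2 : f ≤ 2 := by
      have h := Ideal.absNorm_dvd_absNorm_of_le ((Ideal.span_singleton_le_iff_mem P).mpr hℓP)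
      rw [Ideal.absNorm_span_natCast, hrank, hN] at h
      exact (Nat.pow_dvd_pow_iff_le_right hℓ.one_lt).mp h
    obtain rfl | rfl : f = 1 ∨ f = 2 := by omega
    · rw [pow_one] at hN
      have : Fact ℓ.Prime := ⟨hℓ⟩
      have : Finite (S ⧸ P) := (Ideal.absNorm_ne_zero_iff P).mp hP0
      have := Fintype.ofFinite (S ⧸ P)
      let e := ZMod.ringEquivOfPrime (S ⧸ P) hℓ (by rw [← Nat.card_eq_fintype_card, ← hN]; rfl)
      have hsq : IsSquare (d : ZMod ℓ) := by
        refine ⟨e.symm (Ideal.Quotient.mk P δ), ?_⟩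
        rw [← map_mul, ← map_mul, ← sq, hδ, map_intCast, map_intCast]
      rw [hN] at hgcd ⊢
      rw [← jacobiSym.legendreSym.to_jacobiSym, legendreSym.eq_one_iff]
      · exact hsq
      · intro h0
        rw [ZMod.intCast_zmod_eq_zero_iff_dvd] at h0
        have h1 := Int.dvd_gcd h0 dvd_rfl
        rw [hgcd] at h1
        exact hℓ.not_dvd_one (by exact_mod_cast h1)
    · rw [hN, jacobiSym.pow_right]
      apply jacobiSym.sq_one
      rw [hN] at hgcd
      exact_mod_cast Int.isCoprime_iff_gcd_eq_one.mp
        ((IsCoprime.pow_right_iff two_pos).mp (by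
          have := Int.isCoprime_iff_gcd_eq_one.mpr hgcd
          exact_mod_cast this))

theorem jacobiSym_eq_of_modEq {d : ℤ} (hd : d < 0) (hd4 : d % 4 = 1) {a b : ℕ} (ha : Odd a)
    (hb : Odd b) (h : a ≡ b [MOD d.natAbs]) : J(d | a) = J(d | b) := by
  have key {n : ℕ} (hn : Odd n) : J(d | n) = J((n : ℤ) | d.natAbs) := by
    have hD : d.natAbs % 4 = 3 := by omega
    have hDodd : Odd d.natAbs := Nat.odd_iff.mpr (by omega)
    conv_lhs => rw [show d = -(d.natAbs : ℤ) by omega]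
    rw [jacobiSym.neg _ hn]
    have hn2 := Nat.odd_iff.mp hn
    obtain h1 | h3 : n % 4 = 1 ∨ n % 4 = 3 := by omega
    · rw [ZMod.χ₄_nat_one_mod_four h1, one_mul,
        jacobiSym.quadratic_reciprocity_one_mod_four' hDodd h1]
    · rw [ZMod.χ₄_nat_three_mod_four h3, jacobiSym.quadratic_reciprocity_three_mod_four hD h3]
      ring
  rw [key ha, key hb]
  exact jacobiSym.mod_left' (by exact_mod_cast h)

/-- Every ideal class contains an integral ideal of norm coprime to a given integer. -/
theorem exists_mk0_eq_absNorm_coprime {S : Type*} [CommRing S] [IsDedekindDomain S]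
    [Module.Free ℤ S] [Module.Finite ℤ S] (C : ClassGroup S) {N : ℕ} (hN : 1 < N) :
    ∃ 𝔞 : (Ideal S)⁰, ClassGroup.mk0 𝔞 = C ∧ (Ideal.absNorm (𝔞 : Ideal S)).Coprime N := by
  have : IsAddTorsionFree S := .of_isTorsionFree ℤ _
  have := CharZero.of_isAddTorsionFree S S
  obtain ⟨⟨J, hJ⟩, hJC⟩ := ClassGroup.mk0_surjective C⁻¹
  have hJ0 : J ≠ 0 := nonZeroDivisors.ne_zero hJ
  have hspan0 : Ideal.span {(N : S)} ≠ 0 := by simpa using (zero_lt_one.trans hN).ne'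
  obtain ⟨a, ha⟩ := IsDedekindDomain.exists_sup_span_eq
    (Ideal.mul_le_left : J * Ideal.span {(N : S)} ≤ J) (mul_ne_zero hJ0 hspan0)
  obtain ⟨Q, hQ⟩ : J ∣ Ideal.span {a} := Ideal.dvd_iff_le.mpr (ha ▸ le_sup_right)
  have htop : Ideal.span {(N : S)} ⊔ Q = ⊤ := by
    rw [hQ, ← Ideal.mul_sup] at ha
    exact mul_left_cancel₀ hJ0 (ha.trans (Ideal.mul_top J).symm)
  have hQ0 : Q ≠ 0 := by
    rintro rfl
    rw [Ideal.zero_eq_bot, sup_bot_eq] at htop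
    have h := congrArg Ideal.absNorm htop
    rw [Ideal.absNorm_span_natCast, Ideal.absNorm_top] at h
    exact (Nat.one_lt_pow Module.finrank_pos.ne' hN).ne' h
  refine ⟨⟨Q, mem_nonZeroDivisors_of_ne_zero hQ0⟩, ?_, Nat.Coprime.symm ?_⟩
  · have h1 : ClassGroup.mk0 (⟨J, hJ⟩ * ⟨Q, mem_nonZeroDivisors_of_ne_zero hQ0⟩ : (Ideal S)⁰) = 1 :=
      (ClassGroup.mk0_eq_one_iff _).mpr ⟨a, hQ.symm⟩
    rw [map_mul, hJC] at h1
    exact (inv_mul_eq_one.mp h1).symm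
  · refine Nat.Coprime.symm (Nat.coprime_of_dvd fun ℓ hℓ hℓQ hℓN => ?_)
    obtain ⟨P, hP, hPu, hPQ⟩ := Ideal.exists_isMaximal_dvd_of_dvd_absNorm' hℓ Q hℓQ
    refine hP.ne_top (top_le_iff.mp (htop ▸ sup_le ?_ (Ideal.le_of_dvd hPQ)))
    rw [Ideal.span_singleton_le_iff_mem]
    have hℓP : ((ℓ : ℤ) : ℤ) ∈ P.under ℤ := hPu ▸ Ideal.mem_span_singleton_self _
    rw [Ideal.mem_comap] at hℓP
    obtain ⟨k, rfl⟩ := hℓN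
    rw [Nat.cast_mul]
    exact P.mul_mem_right _ (by simpa using hℓP)

/-- For a suitable residue class modulo `M`, every large prime `p` in it times a nonzero square is
the norm of an integral ideal in the given class. -/
theorem exists_residue_forall_prime_absNorm_eq {K : Type*} [Field K] [NumberField K]
    (hdeg : Module.finrank ℚ K = 2)
    (himag : ∀ φ : K →+* ℂ, ¬ ComplexEmbedding.IsReal φ) (C : ClassGroup (𝓞 K)) {M : ℕ}
    (hdM : (discr K).natAbs ∣ M) (hM4 : M ∣ 4 * (discr K).natAbs)
    (h4M : discr K % 4 = 0 → 4 * (discr K).natAbs ∣ M) :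
    ∃ a B : ℕ, a.Coprime M ∧ ∀ p > B, p.Prime → p ≡ a [MOD M] →
      ∃ I : (Ideal (𝓞 K))⁰, ClassGroup.mk0 I = C ∧
        ∃ t : ℕ, t ≠ 0 ∧ Ideal.absNorm (I : Ideal (𝓞 K)) = p * t ^ 2 := by
  have hd := discr_neg_of_not_isReal hdeg himag
  obtain ⟨s, c, δ, hdsc, hδ, hnorm⟩ := exists_sq_eq_discr hdeg
  set d := discr K
  have hd4 : d % 4 = 0 ∨ d % 4 = 1 := by
    have h : s ^ 2 % 4 = 0 ∨ s ^ 2 % 4 = 1 := by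
      rcases Int.even_or_odd' s with ⟨k, rfl | rfl⟩ <;> ring_nf <;> omega
    omega
  obtain ⟨⟨𝔞, h𝔞⟩, h𝔞C, hcop⟩ := exists_mk0_eq_absNorm_coprime C⁻¹
    (show 1 < 4 * d.natAbs by omega)
  have h𝔞0 : 𝔞 ≠ 0 := nonZeroDivisors.ne_zero h𝔞
  change (Ideal.absNorm 𝔞).Coprime _ at hcop
  set n := Ideal.absNorm 𝔞 with hn
  have hn0 : n ≠ 0 := fun h => h𝔞0 (Ideal.absNorm_eq_zero_iff.mp h)
  have hnd : n.Coprime d.natAbs := hcop.coprime_mul_left_right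
  have hnodd : Odd n := by
    have : n.Coprime (2 * 2) := hcop.coprime_mul_right_right
    exact (Nat.coprime_two_right.mp this.coprime_mul_left_right)
  refine ⟨n, max n 2, hcop.coprime_dvd_right hM4, fun p hpB hp hpM => ?_⟩
  have hpn : n < p := (le_max_left _ _).trans_lt hpB
  have hpodd : Odd p := hp.odd_of_ne_two ((le_max_right _ _).trans_lt hpB).ne'
  have hJn : J(d | n) = 1 :=
    jacobiSym_absNorm_eq_one (by rw [RingOfIntegers.rank, hdeg]) hδ 𝔞 hnd
  have hJp : J(d | p) = 1 := by
    rw [← hJn]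
    obtain h | h := hd4
    · rw [jacobiSym.mod_right _ hpodd, jacobiSym.mod_right _ hnodd, hpM.of_dvd (h4M h)]
    · exact jacobiSym_eq_of_modEq hd h hpodd hnodd (hpM.of_dvd hdM)
  have : Fact p.Prime := ⟨hp⟩
  obtain ⟨α, w, hw, hα⟩ := exists_norm_eq_mul_sq hd hnorm hn0 hnd hp
    (fun h => (Nat.le_of_dvd (Nat.pos_of_ne_zero hn0) h).not_gt hpn)
    ((ZMod.natCast_eq_natCast_iff _ _ _).mpr (hpM.of_dvd hdM))
    (ZMod.isSquare_of_jacobiSym_eq_one hJp)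
  obtain ⟨𝔠, h𝔠⟩ : 𝔞 ∣ Ideal.span {(n : 𝓞 K)} :=
    Ideal.dvd_iff_le.mpr (Ideal.span_singleton_absNorm_le 𝔞)
  have hN𝔠 : Ideal.absNorm 𝔠 = n := by
    have h := congrArg Ideal.absNorm h𝔠
    rw [Ideal.absNorm_span_natCast, RingOfIntegers.rank, hdeg, map_mul, ← hn, sq] at h
    exact (Nat.eq_of_mul_eq_mul_left (Nat.pos_of_ne_zero hn0) h).symm
  have h𝔠0 : 𝔠 ≠ 0 := by
    rintro rfl
    exact hn0 (by rw [← hN𝔠, Ideal.zero_eq_bot, Ideal.absNorm_bot])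
  have hα0 : Ideal.span {α} ≠ 0 := by
    intro h
    rw [Ideal.zero_eq_bot, Ideal.span_singleton_eq_bot] at h
    rw [h, Algebra.norm_zero] at hα
    have : p * n * w ^ 2 = 0 := by exact_mod_cast hα.symm
    simp [hp.ne_zero, hn0, hw] at this
  have h𝔠mem := mem_nonZeroDivisors_of_ne_zero h𝔠0
  have hαmem := mem_nonZeroDivisors_of_ne_zero hα0
  refine ⟨⟨_, hαmem⟩ * ⟨𝔠, h𝔠mem⟩, ?_, n * w, mul_ne_zero hn0 hw, ?_⟩
  · have h1 : ClassGroup.mk0 (⟨𝔞, h𝔞⟩ * ⟨𝔠, h𝔠mem⟩ : (Ideal (𝓞 K))⁰) = 1 :=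
      (ClassGroup.mk0_eq_one_iff _).mpr ⟨(n : 𝓞 K), h𝔠.symm⟩
    have h2 : ClassGroup.mk0 (⟨_, hαmem⟩ : (Ideal (𝓞 K))⁰) = 1 :=
      (ClassGroup.mk0_eq_one_iff _).mpr ⟨α, rfl⟩
    rw [map_mul, h𝔞C] at h1
    rw [map_mul, h2, one_mul]
    exact (inv_mul_eq_one.mp h1).symm
  · change Ideal.absNorm (Ideal.span {α} * 𝔠) = _
    have h3 : (Algebra.norm ℤ α).natAbs = p * n * w ^ 2 := by
      rw [hα]
      exact_mod_cast Int.natAbs_natCast (p * n * w ^ 2)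
    rw [map_mul, Ideal.absNorm_span_singleton, h3, hN𝔠]
    ring

/-- Scaling an ideal by a positive integer keeps its class and multiplies its norm by a square. -/
theorem exists_mk0_eq_absNorm_eq_mul_sq {K : Type*} [Field K] [NumberField K]
    (hdeg : Module.finrank ℚ K = 2) (I : (Ideal (𝓞 K))⁰) {t : ℕ} (ht : t ≠ 0) :
    ∃ I' : (Ideal (𝓞 K))⁰, ClassGroup.mk0 I' = ClassGroup.mk0 I ∧
      Ideal.absNorm (I' : Ideal (𝓞 K)) = Ideal.absNorm (I : Ideal (𝓞 K)) * t ^ 2 := by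
  have hspan : Ideal.span {(t : 𝓞 K)} ∈ (Ideal (𝓞 K))⁰ :=
    mem_nonZeroDivisors_of_ne_zero (by simpa using ht)
  refine ⟨I * ⟨_, hspan⟩, ?_, ?_⟩
  · rw [map_mul, (ClassGroup.mk0_eq_one_iff hspan).mpr ⟨(t : 𝓞 K), rfl⟩, mul_one]
  · rw [Submonoid.coe_mul, map_mul, Ideal.absNorm_span_natCast, RingOfIntegers.rank, hdeg]

/-- A period of the Kronecker symbol `n ↦ (d / n)` on odd `n` for `d` congruent to `0` or `1`
modulo `4`. -/
def kroneckerModulus (d : ℤ) : ℕ := if d % 4 = 0 then 4 * d.natAbs else d.natAbs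

theorem dvd_kroneckerModulus (d : ℤ) : d.natAbs ∣ kroneckerModulus d := by
  unfold kroneckerModulus
  split_ifs
  exacts [dvd_mul_left _ _, dvd_rfl]

theorem kroneckerModulus_dvd (d : ℤ) : kroneckerModulus d ∣ 4 * d.natAbs := by
  unfold kroneckerModulus
  split_ifs
  exacts [dvd_rfl, dvd_mul_left _ _]

theorem kroneckerModulus_ne_zero {d : ℤ} (hd : d ≠ 0) : kroneckerModulus d ≠ 0 := by
  unfold kroneckerModulus
  split_ifs <;> omega

theorem kroneckerModulus_coprime {d₁ d₂ : ℤ} (h : IsCoprime d₁ d₂) :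
    (kroneckerModulus d₁).Coprime (kroneckerModulus d₂) := by
  have hcop : d₁.natAbs.Coprime d₂.natAbs := Int.isCoprime_iff_gcd_eq_one.mp h
  have key {a b : ℤ} (hab : a.natAbs.Coprime b.natAbs) (ha : a % 4 = 0) : Nat.Coprime 4 b.natAbs :=
    hab.coprime_dvd_left (by omega)
  unfold kroneckerModulus
  split_ifs with h1 h2 h2
  · have := (key hcop h1).coprime_dvd_right (show 4 ∣ d₂.natAbs by omega)
    norm_num at this
  · exact Nat.Coprime.mul_left (key hcop h1) hcop
  · exact Nat.Coprime.mul_right (key hcop.symm h2).symm hcop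
  · exact hcop

/-- **Lemma 3.8 (Yang–Yin).** Let `K₁`, `K₂` be imaginary quadratic number fields whose
discriminants are coprime. Then any pair of ideal classes `C₁ ∈ Cl(K₁)`, `C₂ ∈ Cl(K₂)`
can be represented by nonzero integral ideals `a₁ ⊆ 𝒪_{K₁}`, `a₂ ⊆ 𝒪_{K₂}` with equal
absolute norms. -/
theorem stmt0 (K₁ K₂ : Type*) [Field K₁] [Field K₂] [NumberField K₁] [NumberField K₂]
    (hdeg₁ : Module.finrank ℚ K₁ = 2) (hdeg₂ : Module.finrank ℚ K₂ = 2)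
    (himag₁ : ∀ φ : K₁ →+* ℂ, ¬ NumberField.ComplexEmbedding.IsReal φ)
    (himag₂ : ∀ φ : K₂ →+* ℂ, ¬ NumberField.ComplexEmbedding.IsReal φ)
    (hcop : IsCoprime (NumberField.discr K₁) (NumberField.discr K₂))
    (C₁ : ClassGroup (𝓞 K₁)) (C₂ : ClassGroup (𝓞 K₂)) :
    ∃ (a₁ : (Ideal (𝓞 K₁))⁰) (a₂ : (Ideal (𝓞 K₂))⁰),
      ClassGroup.mk0 a₁ = C₁ ∧ ClassGroup.mk0 a₂ = C₂ ∧
      Ideal.absNorm (a₁ : Ideal (𝓞 K₁)) = Ideal.absNorm (a₂ : Ideal (𝓞 K₂)) := by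
  obtain ⟨x₁, B₁, hx₁, H₁⟩ := exists_residue_forall_prime_absNorm_eq hdeg₁ himag₁ C₁
    (dvd_kroneckerModulus _) (kroneckerModulus_dvd _) (fun h => (if_pos h).symm.dvd)
  obtain ⟨x₂, B₂, hx₂, H₂⟩ := exists_residue_forall_prime_absNorm_eq hdeg₂ himag₂ C₂
    (dvd_kroneckerModulus _) (kroneckerModulus_dvd _) (fun h => (if_pos h).symm.dvd)
  have hM := kroneckerModulus_coprime hcop
  obtain ⟨x, hxx₁, hxx₂⟩ := Nat.chineseRemainder hM x₁ x₂
  have hx : x.Coprime (kroneckerModulus (discr K₁) * kroneckerModulus (discr K₂)) :=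
    Nat.Coprime.mul_right (hxx₁.gcd_eq.trans hx₁) (hxx₂.gcd_eq.trans hx₂)
  obtain ⟨p, hpB, hp, hpx⟩ := Nat.forall_exists_prime_gt_and_modEq (max B₁ B₂)
    (mul_ne_zero (kroneckerModulus_ne_zero (discr_ne_zero K₁))
      (kroneckerModulus_ne_zero (discr_ne_zero K₂))) hx
  obtain ⟨I₁, hI₁, t₁, ht₁, hN₁⟩ := H₁ p ((le_max_left _ _).trans_lt hpB) hp
    ((hpx.of_mul_right _).trans hxx₁)
  obtain ⟨I₂, hI₂, t₂, ht₂, hN₂⟩ := H₂ p ((le_max_right _ _).trans_lt hpB) hp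
    ((hpx.of_mul_left _).trans hxx₂)
  obtain ⟨a₁, ha₁, hNa₁⟩ := exists_mk0_eq_absNorm_eq_mul_sq hdeg₁ I₁ ht₂
  obtain ⟨a₂, ha₂, hNa₂⟩ := exists_mk0_eq_absNorm_eq_mul_sq hdeg₂ I₂ ht₁
  refine ⟨a₁, a₂, ha₁.trans hI₁, ha₂.trans hI₂, ?_⟩
  rw [hNa₁, hNa₂, hN₁, hN₂]
  ring
end

section
/- For every b ∈ ℚ₂, the integral ∫_{M₁} ψ(b·x₁x₂) d(μ×μ)(x₁,x₂) equals 1/2 if ‖b‖ ≤ 2 and equals 0 if ‖b‖ > 2. (This is the formula J₁(b) = (1/2)·Char((1/2)ℤ₂)(b) in the proof of Lemma 5.5.) -/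
open MeasureTheory

/-- `M_a = {(x₁,x₂) ∈ ℤ₂² : x₁ + x₂ ≡ a (mod 2)}` from the proof of Lemma 5.5. -/
def Mset (a : ℕ) : Set (ℚ_[2] × ℚ_[2]) :=
  {p | ‖p.1‖ ≤ 1 ∧ ‖p.2‖ ≤ 1 ∧ ‖p.1 + p.2 - (a : ℚ_[2])‖ ≤ 1 / 2}

section

variable {ψ : ℚ_[2] → ℂ}

theorem padic_two_norm_le_one_iff (x : ℚ_[2]) : ‖x‖ ≤ 1 ↔ ‖x‖ ≤ 1 / 2 ∨ ‖x - 1‖ ≤ 1 / 2 := by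
  constructor
  · intro hx
    obtain ⟨n, hn, hmem⟩ := PadicInt.exists_mem_range (p := 2) ⟨x, hx⟩
    rw [IsLocalRing.mem_maximalIdeal, PadicInt.mem_nonunits,
      PadicInt.norm_lt_one_iff_dvd, ← pow_one ((2 : ℕ) : ℤ_[2]),
      ← Ideal.mem_span_singleton, ← PadicInt.norm_le_pow_iff_mem_span_pow] at hmem
    have h : ‖x - (n : ℚ_[2])‖ ≤ 1 / 2 := by
      rw [PadicInt.norm_def] at hmem
      norm_num at hmem ⊢
      exact hmem
    interval_cases n
    · left; simpa using h
    · right; simpa using h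
  · rintro (h | h)
    · linarith
    · have := Padic.nonarchimedean (x - 1) 1
      rw [sub_add_cancel, norm_one] at this
      exact this.trans (max_le (by linarith) le_rfl)

theorem padic_two_norm_eq_one_of_norm_sub_one_le {x : ℚ_[2]} (hx : ‖x - 1‖ ≤ 1 / 2) : ‖x‖ = 1 := by
  refine le_antisymm ((padic_two_norm_le_one_iff x).2 (.inr hx)) ?_
  by_contra! h
  have := Padic.nonarchimedean x (-(x - 1))
  rw [norm_neg, ← sub_eq_add_neg, sub_sub_cancel, norm_one] at this
  exact absurd this (not_le.2 (max_lt h (by linarith)))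

theorem Mset_one_eq_union :
    Mset 1 = Metric.closedBall (0 : ℚ_[2]) (1 / 2) ×ˢ Metric.closedBall (1 : ℚ_[2]) (1 / 2) ∪
      Metric.closedBall (1 : ℚ_[2]) (1 / 2) ×ˢ Metric.closedBall (0 : ℚ_[2]) (1 / 2) := by
  have add_le {x y : ℚ_[2]} (hx : ‖x‖ ≤ 1 / 2) (hy : ‖y‖ ≤ 1 / 2) : ‖x + y‖ ≤ 1 / 2 :=
    (Padic.nonarchimedean x y).trans (max_le hx hy)
  have sub_le {x y : ℚ_[2]} (hx : ‖x‖ ≤ 1 / 2) (hy : ‖y‖ ≤ 1 / 2) : ‖x - y‖ ≤ 1 / 2 := by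
    rw [sub_eq_add_neg]
    exact add_le hx (by rwa [norm_neg])
  have one_not : ¬ ‖(1 : ℚ_[2])‖ ≤ 1 / 2 := by norm_num
  ext ⟨x, y⟩
  simp only [Mset, Set.mem_ofPred_eq, Set.mem_union, Set.mem_prod, mem_closedBall_iff_norm,
    sub_zero, Nat.cast_one]
  constructor
  · rintro ⟨hx, hy, h⟩
    rcases (padic_two_norm_le_one_iff x).1 hx with hx | hx <;>
      rcases (padic_two_norm_le_one_iff y).1 hy with hy | hy
    · refine absurd (sub_le (add_le hx hy) h) ?_
      rwa [sub_sub_cancel]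
    · exact .inl ⟨hx, hy⟩
    · exact .inr ⟨hx, hy⟩
    · refine absurd (sub_le h (add_le hx hy)) ?_
      rwa [show x + y - 1 - (x - 1 + (y - 1)) = 1 by ring]
  · rintro (⟨hx, hy⟩ | ⟨hx, hy⟩)
    · refine ⟨(padic_two_norm_le_one_iff x).2 (.inl hx),
        (padic_two_norm_le_one_iff y).2 (.inr hy), ?_⟩
      rw [add_sub_assoc]
      exact add_le hx hy
    · refine ⟨(padic_two_norm_le_one_iff x).2 (.inr hx),
        (padic_two_norm_le_one_iff y).2 (.inl hy), ?_⟩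
      rw [add_sub_right_comm]
      exact add_le hx hy

theorem disjoint_closedBall_zero_one :
    Disjoint (Metric.closedBall (0 : ℚ_[2]) (1 / 2)) (Metric.closedBall 1 (1 / 2)) := by
  rw [Set.disjoint_left]
  intro x hx hx'
  rw [mem_closedBall_iff_norm] at hx hx'
  have := padic_two_norm_eq_one_of_norm_sub_one_le hx'
  rw [sub_zero] at hx
  linarith

variable [MeasurableSpace ℚ_[2]] [BorelSpace ℚ_[2]] (μ : Measure ℚ_[2]) [μ.IsAddHaarMeasure]

theorem measureReal_closedBall_one_half :
    μ.real (Metric.closedBall (1 : ℚ_[2]) (1 / 2)) = μ.real (Metric.closedBall 0 (1 / 2)) := by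
  have h := measure_preimage_add μ (1 : ℚ_[2]) (Metric.closedBall 1 (1 / 2))
  rw [preimage_add_closedBall, sub_self] at h
  simp only [Measure.real, h]

theorem measureReal_closedBall_zero_half (hμ : μ {x : ℚ_[2] | ‖x‖ ≤ 1} = 1) :
    μ.real (Metric.closedBall (0 : ℚ_[2]) (1 / 2)) = 1 / 2 := by
  have hU : {x : ℚ_[2] | ‖x‖ ≤ 1} =
      Metric.closedBall 0 (1 / 2) ∪ Metric.closedBall 1 (1 / 2) := by
    ext x
    simp only [Set.mem_ofPred_eq, Set.mem_union, mem_closedBall_iff_norm, sub_zero]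
    exact padic_two_norm_le_one_iff x
  have h : μ.real {x : ℚ_[2] | ‖x‖ ≤ 1} = 1 := by simp [Measure.real, hμ]
  rw [hU, measureReal_union disjoint_closedBall_zero_one measurableSet_closedBall
    measure_closedBall_lt_top.ne measure_closedBall_lt_top.ne, measureReal_closedBall_one_half] at h
  linarith

theorem setIntegral_character_eq_zero
    (hψadd : ∀ x y : ℚ_[2], ψ (x + y) = ψ x * ψ y) (hψhalf : ψ (2⁻¹ : ℚ_[2]) = -1)
    {c : ℚ_[2]} (hc : 2 < ‖c‖) :
    ∫ x in Metric.closedBall (0 : ℚ_[2]) (1 / 2), ψ (c * x) ∂μ = 0 := by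
  have hc0 : c ≠ 0 := norm_pos_iff.1 (by linarith)
  have norm_two : ‖(2 : ℚ_[2])‖ = 2⁻¹ := by simpa using Padic.norm_p (p := 2)
  set t : ℚ_[2] := c⁻¹ * 2⁻¹ with ht
  have hct : c * t = 2⁻¹ := by rw [ht, mul_inv_cancel_left₀ hc0]
  have hc4 : 4 ≤ ‖c‖ := by
    have hn := Padic.norm_eq_zpow_neg_valuation hc0
    have h1 : (1 : ℤ) < -c.valuation := by
      rw [hn] at hc
      exact (zpow_lt_zpow_iff_right₀ (by norm_num : (1 : ℝ) < 2)).1 (by simpa using hc)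
    have h2 := zpow_le_zpow_right₀ (by norm_num : (1 : ℝ) ≤ 2) (Int.add_one_le_iff.2 h1)
    rw [hn]
    norm_num at h2 ⊢
    exact h2
  have htn : ‖t‖ ≤ 1 / 2 := by
    rw [ht, norm_mul, norm_inv, norm_inv, norm_two, inv_inv, inv_mul_le_iff₀ (by linarith)]
    linarith
  have hball : (· + t) ⁻¹' Metric.closedBall (0 : ℚ_[2]) (1 / 2) = Metric.closedBall 0 (1 / 2) := by
    ext x
    simp only [Set.mem_preimage, mem_closedBall_iff_norm, sub_zero]
    constructor <;> intro h
    · have := Padic.nonarchimedean (x + t) (-t)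
      rw [add_neg_cancel_right, norm_neg] at this
      exact this.trans (max_le h htn)
    · exact (Padic.nonarchimedean x t).trans (max_le h htn)
  have h := (measurePreserving_add_right μ t).setIntegral_preimage_emb
    (measurableEmbedding_addRight t) (fun x => ψ (c * x)) (Metric.closedBall 0 (1 / 2))
  simp only [hball, mul_add, hψadd, hct, hψhalf, mul_neg_one, integral_neg] at h
  exact self_eq_neg.1 h.symm

end

/-- **Paper, proof of Lemma 5.5:** `J₁(b) = (1/2)·Char((1/2)ℤ₂)(b)`, i.e.
`∫_{M₁} ψ(b x₁ x₂) d(μ×μ)` equals `1/2` when `‖b‖ ≤ 2` and `0` when `‖b‖ > 2`. -/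
theorem stmt10 [MeasurableSpace ℚ_[2]] [BorelSpace ℚ_[2]]
    (μ : Measure ℚ_[2]) [μ.IsAddHaarMeasure] [SigmaFinite μ]
    (hμ : μ {x : ℚ_[2] | ‖x‖ ≤ 1} = 1)
    (ψ : ℚ_[2] → ℂ) (hψcont : Continuous ψ)
    (hψadd : ∀ x y : ℚ_[2], ψ (x + y) = ψ x * ψ y)
    (hψtriv : ∀ x : ℚ_[2], ‖x‖ ≤ 1 → ψ x = 1)
    (hψhalf : ψ (2⁻¹ : ℚ_[2]) = -1)
    (b : ℚ_[2]) :
    (∫ p in Mset 1, ψ (b * p.1 * p.2) ∂(μ.prod μ))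
      = if ‖b‖ ≤ 2 then (1 / 2 : ℂ) else 0 := by
  set E := Metric.closedBall (0 : ℚ_[2]) (1 / 2)
  set O := Metric.closedBall (1 : ℚ_[2]) (1 / 2)
  have hEc : IsCompact E := isCompact_closedBall _ _
  have hOc : IsCompact O := isCompact_closedBall _ _
  have hcont : Continuous fun p : ℚ_[2] × ℚ_[2] => ψ (b * p.1 * p.2) := by fun_prop
  have hEO := hcont.continuousOn.integrableOn_compact (μ := μ.prod μ) (hEc.prod hOc)
  have hOE := hcont.continuousOn.integrableOn_compact (μ := μ.prod μ) (hOc.prod hEc)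
  have hswap : ∫ p in E ×ˢ O, ψ (b * p.1 * p.2) ∂(μ.prod μ) =
      ∫ p in O ×ˢ E, ψ (b * p.1 * p.2) ∂(μ.prod μ) := by
    rw [← setIntegral_prod_swap]
    simp only [Prod.fst_swap, Prod.snd_swap, mul_right_comm]
  have hdisj : Disjoint (E ×ˢ O) (O ×ˢ E) :=
    Set.disjoint_prod.2 (.inl disjoint_closedBall_zero_one)
  rw [Mset_one_eq_union, setIntegral_union hdisj (hOc.measurableSet.prod hEc.measurableSet)
    hEO hOE, hswap, ← two_mul, setIntegral_prod _ hOE]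
  have hO {x : ℚ_[2]} (hx : x ∈ O) : ‖x‖ = 1 :=
    padic_two_norm_eq_one_of_norm_sub_one_le (mem_closedBall_iff_norm.1 hx)
  split_ifs with hb
  · have hinner (x : ℚ_[2]) (hx : x ∈ O) : ∫ y in E, ψ (b * x * y) ∂μ = 1 / 2 := by
      have h (y : ℚ_[2]) (hy : y ∈ E) : ψ (b * x * y) = 1 := by
        apply hψtriv
        rw [norm_mul, norm_mul, hO hx, mul_one]
        have := mul_le_mul hb (mem_closedBall_zero_iff.1 hy) (norm_nonneg _) zero_le_two
        linarith
      rw [setIntegral_congr_fun hEc.measurableSet h, setIntegral_const,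
        measureReal_closedBall_zero_half μ hμ]
      norm_num
    rw [setIntegral_congr_fun hOc.measurableSet hinner, setIntegral_const,
      measureReal_closedBall_one_half, measureReal_closedBall_zero_half μ hμ]
    norm_num
  · have hinner (x : ℚ_[2]) (hx : x ∈ O) : ∫ y in E, ψ (b * x * y) ∂μ = 0 := by
      apply setIntegral_character_eq_zero μ hψadd hψhalf
      rw [norm_mul, hO hx, mul_one]
      exact not_le.1 hb
    rw [setIntegral_congr_fun hOc.measurableSet hinner]
    simp
end

section
/- For every real s > 0 and nonzero t ∈ ℚ₂, the integral I₀(s,t) := ∫_{ℚ₂} (∫_{M₀} ψ(b·x₁x₂) d(μ×μ)) · ψ(−t·b) · min(1, ‖b‖⁻¹)^s dμ(b) converges absolutely and equals: 0 if ‖t‖ > 1; 1/2 if ‖t‖ = 1; and 1/2 − 2^{−s} + (1 − 2^{−1−s})·Σ_{n=1}^{o} 2^{−ns} if ‖t‖ = 2^{−o} with o ≥ 1. (This is the normalized local Whittaker function W_{tα}(s, φ₀)/γ(W) of Lemma 5.5(1), with the 2-adic unit α absorbed into t; in particular its value at s = 0 is 1/2 when o = 0 and (o−1)/2 when o ≥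 1.) -/
open MeasureTheory

section Padic

open Metric

lemma norm_le_two_zpow_iff_lt (x : ℚ_[2]) (n : ℤ) :
    ‖x‖ ≤ (2 : ℝ) ^ n ↔ ‖x‖ < (2 : ℝ) ^ (n + 1) := by
  simpa using Padic.norm_le_pow_iff_norm_lt_pow_add_one x n

lemma norm_two_zpow (n : ℤ) : ‖(2 : ℚ_[2]) ^ n‖ = (2 : ℝ) ^ (-n) := by
  simpa using Padic.norm_p_zpow (p := 2) n

lemma exists_norm_eq_two_zpow {x : ℚ_[2]} (hx : x ≠ 0) : ∃ n : ℤ, ‖x‖ = (2 : ℝ) ^ n :=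
  ⟨-x.valuation, by simpa using Padic.norm_eq_zpow_neg_valuation hx⟩

lemma norm_sub_one_le_half {x : ℚ_[2]} (hx : ‖x‖ = 1) : ‖x - 1‖ ≤ (2 : ℝ) ^ (-1 : ℤ) := by
  obtain ⟨z, rfl⟩ : ∃ z : ℤ_[2], (z : ℚ_[2]) = x := ⟨⟨x, hx.le⟩, rfl⟩
  obtain ⟨n, hn, hmem⟩ := PadicInt.exists_mem_range z
  rw [IsLocalRing.mem_maximalIdeal, PadicInt.mem_nonunits, PadicInt.norm_def] at hmem
  rw [norm_le_two_zpow_iff_lt]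
  interval_cases n
  · rw [Nat.cast_zero, sub_zero] at hmem
    exact absurd hx hmem.ne
  · simpa using hmem

lemma norm_sub_le_of_norm_eq {x y : ℚ_[2]} {n : ℤ} (hx : ‖x‖ = (2 : ℝ) ^ (n + 1))
    (hy : ‖y‖ = (2 : ℝ) ^ (n + 1)) : ‖x - y‖ ≤ (2 : ℝ) ^ n := by
  have hy0 : y ≠ 0 := by
    rw [← norm_ne_zero_iff, hy]; positivity
  have h := norm_sub_one_le_half (x := x / y) (by rw [norm_div, hx, hy]; field_simp)
  have hxy : x - y = (x / y - 1) * y := by field_simp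
  calc ‖x - y‖ = ‖x / y - 1‖ * (2 : ℝ) ^ (n + 1) := by rw [hxy, norm_mul, hy]
    _ ≤ (2 : ℝ) ^ (-1 : ℤ) * (2 : ℝ) ^ (n + 1) := by gcongr
    _ = (2 : ℝ) ^ n := by rw [← zpow_add₀ two_ne_zero]; congr 1; ring

lemma norm_eq_one_of_norm_sub_one_le {x : ℚ_[2]} (hx : ‖x - 1‖ ≤ (2 : ℝ) ^ (-1 : ℤ)) :
    ‖x‖ = 1 := by
  have hlt : ‖x - 1‖ < 1 := hx.trans_lt (by norm_num)
  have h1 := IsUltrametricDist.norm_add_le_max (x - 1) 1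
  rw [sub_add_cancel, norm_one, max_eq_right hlt.le] at h1
  have h2 := IsUltrametricDist.norm_add_le_max x (-(x - 1))
  rw [norm_neg, show x + -(x - 1) = 1 by ring, norm_one] at h2
  exact le_antisymm h1 ((le_max_iff.1 h2).resolve_right hlt.not_ge)

lemma Mset_zero_eq : Mset 0 =
    closedBall (0 : ℚ_[2]) (2 ^ (-1 : ℤ)) ×ˢ closedBall (0 : ℚ_[2]) (2 ^ (-1 : ℤ)) ∪
      closedBall (1 : ℚ_[2]) (2 ^ (-1 : ℤ)) ×ˢ closedBall (1 : ℚ_[2]) (2 ^ (-1 : ℤ)) := by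
  have hhalf : (1 / 2 : ℝ) = 2 ^ (-1 : ℤ) := by norm_num
  have hle : (2 : ℝ) ^ (-1 : ℤ) ≤ 1 := by norm_num
  have key : ∀ x : ℚ_[2], ‖x‖ ≤ 1 → ‖x‖ ≤ 2 ^ (-1 : ℤ) ∨ ‖x - 1‖ ≤ (2 : ℝ) ^ (-1 : ℤ) := by
    intro x hx
    rcases hx.lt_or_eq with h | h
    · exact Or.inl ((norm_le_two_zpow_iff_lt x (-1)).2 (by simpa using h))
    · exact Or.inr (norm_sub_one_le_half h)
  have hadd : ∀ x y : ℚ_[2], ‖x‖ ≤ 2 ^ (-1 : ℤ) → ‖y‖ ≤ 2 ^ (-1 : ℤ) →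
      ‖x + y‖ ≤ (2 : ℝ) ^ (-1 : ℤ) := fun x y hx hy =>
    (IsUltrametricDist.norm_add_le_max x y).trans (max_le hx hy)
  have hsub : ∀ x y : ℚ_[2], ‖x‖ ≤ 2 ^ (-1 : ℤ) → ‖y‖ ≤ 2 ^ (-1 : ℤ) →
      ‖x - y‖ ≤ (2 : ℝ) ^ (-1 : ℤ) := fun x y hx hy => by
    rw [sub_eq_add_neg]
    exact hadd x (-y) hx (by rwa [norm_neg])
  have htwo : ‖(2 : ℚ_[2])‖ ≤ 2 ^ (-1 : ℤ) := by simpa using (norm_two_zpow 1).le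
  ext ⟨x, y⟩
  simp only [Mset, Set.mem_ofPred_eq, Set.mem_union, Set.mem_prod, mem_closedBall, dist_eq_norm,
    sub_zero, hhalf, Nat.cast_zero]
  constructor
  · rintro ⟨hx, hy, hxy⟩
    rcases key x hx with h | h
    · exact Or.inl ⟨h, by simpa using hsub _ _ hxy h⟩
    · refine Or.inr ⟨h, ?_⟩
      have := hsub _ _ (hsub _ _ hxy h) htwo
      rw [show y - 1 = x + y - (x - 1) - 2 by ring]
      exact this
  · rintro (⟨hx, hy⟩ | ⟨hx, hy⟩)
    · exact ⟨hx.trans hle, hy.trans hle, hadd _ _ hx hy⟩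
    · refine ⟨(norm_eq_one_of_norm_sub_one_le hx).le, (norm_eq_one_of_norm_sub_one_le hy).le, ?_⟩
      rw [show x + y = (x - 1) + (y - 1) + 2 by ring]
      exact hadd _ _ (hadd _ _ hx hy) htwo

variable {ψ : ℚ_[2] → ℂ}

lemma norm_addChar_eq_one (hψadd : ∀ x y : ℚ_[2], ψ (x + y) = ψ x * ψ y)
    (hψtriv : ∀ x : ℚ_[2], ‖x‖ ≤ 1 → ψ x = 1) (x : ℚ_[2]) : ‖ψ x‖ = 1 := by
  have hpow : ∀ n : ℕ, ψ (2 ^ n * x) = ψ x ^ 2 ^ n := by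
    intro n
    induction n with
    | zero => simp
    | succ n ih => rw [pow_succ, pow_succ, pow_mul, ← ih, mul_right_comm, mul_two, hψadd, sq]
  obtain ⟨n, hn⟩ := pow_unbounded_of_one_lt ‖x‖ one_lt_two
  have h2 : ‖(2 : ℚ_[2])‖ = 2⁻¹ := by simpa using Padic.norm_p (p := 2)
  have h : ψ x ^ 2 ^ n = 1 := by
    rw [← hpow]
    apply hψtriv
    rw [norm_mul, norm_pow, h2, inv_pow, inv_mul_le_iff₀ (by positivity)]
    linarith
  exact Complex.norm_eq_one_of_pow_eq_one h (by positivity)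

lemma addChar_eq_neg_one (hψadd : ∀ x y : ℚ_[2], ψ (x + y) = ψ x * ψ y)
    (hψtriv : ∀ x : ℚ_[2], ‖x‖ ≤ 1 → ψ x = 1) (hψhalf : ψ (2⁻¹ : ℚ_[2]) = -1)
    {x : ℚ_[2]} (hx : ‖x‖ = 2) : ψ x = -1 := by
  have h2 : ‖(2⁻¹ : ℚ_[2])‖ = 2 := by simpa using norm_two_zpow (-1)
  have := norm_sub_le_of_norm_eq (x := x) (y := 2⁻¹) (n := 0) (by simpa using hx)
    (by rw [h2]; norm_num)
  rw [← sub_add_cancel x 2⁻¹, hψadd, hψhalf, hψtriv _ (by simpa using this), one_mul]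

/-- The value of `∫_{M₀} ψ(b x₁ x₂)` on the shell `max 1 ‖b‖ = 2 ^ k`. -/
noncomputable def shellCoeff (k : ℕ) : ℂ :=
  if k = 0 then 1 / 2 else if k = 1 then 0 else (1 / 2) ^ k

lemma norm_shellCoeff_mul_le (k : ℕ) : ‖shellCoeff k‖ * 2 ^ k ≤ 1 := by
  rcases k with _ | _ | k
  · norm_num [shellCoeff]
  · norm_num [shellCoeff]
  · simp [shellCoeff]

/-- The shells `max 1 ‖b‖ = 2 ^ k` partition `ℚ₂`. -/
def shell (k : ℕ) : Set ℚ_[2] := {b | max 1 ‖b‖ = 2 ^ k}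

lemma shell_zero : shell 0 = closedBall (0 : ℚ_[2]) (2 ^ (0 : ℤ)) := by
  ext b
  simp [shell]

lemma shell_succ (k : ℕ) : shell (k + 1) =
    closedBall (0 : ℚ_[2]) (2 ^ ((k + 1 : ℕ) : ℤ)) \ closedBall 0 (2 ^ (k : ℤ)) := by
  ext b
  simp only [shell, Set.mem_ofPred_eq, Set.mem_sdiff, mem_closedBall, dist_zero_right]
  rw [norm_le_two_zpow_iff_lt b k, not_lt, ← Nat.cast_add_one, zpow_natCast,
    ← le_antisymm_iff]
  have h1 : (1 : ℝ) < 2 ^ (k + 1) := one_lt_pow₀ one_lt_two (by lia)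
  constructor
  · intro h
    rcases max_choice 1 ‖b‖ with h' | h' <;> rw [h'] at h
    · exact absurd h h1.ne
    · exact h
  · intro h
    rw [h, max_eq_right h1.le]

lemma iUnion_shell : ⋃ k, shell k = Set.univ := by
  rw [Set.eq_univ_iff_forall]
  intro b
  rw [Set.mem_iUnion]
  rcases le_or_gt ‖b‖ 1 with h | h
  · exact ⟨0, by simpa [shell] using h⟩
  · have hb : b ≠ 0 := by
      rintro rfl
      rw [norm_zero] at h
      linarith
    obtain ⟨n, hn⟩ := exists_norm_eq_two_zpow hb
    have hn0 : 0 ≤ n := by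
      rw [hn] at h
      exact ((one_lt_zpow_iff_right₀ one_lt_two).1 h).le
    lift n to ℕ using hn0
    exact ⟨n, by rw [shell, Set.mem_ofPred_eq, max_eq_right h.le, hn, zpow_natCast]⟩

lemma pairwise_disjoint_shell : Pairwise (Function.onFun Disjoint shell) := by
  intro i j hij
  rw [Function.onFun, Set.disjoint_left]
  intro b hi hj
  exact hij (pow_right_injective₀ two_pos (by norm_num) (hi.symm.trans hj))

lemma shell_subset (k : ℕ) : shell k ⊆ closedBall (0 : ℚ_[2]) (2 ^ (k : ℤ)) := by
  intro b hb
  rw [mem_closedBall, dist_zero_right, zpow_natCast, ← show max 1 ‖b‖ = 2 ^ k from hb]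
  exact le_max_right _ _

/-- The value of `∫ ψ(c b)` over the shell `max 1 ‖b‖ = 2 ^ k`. -/
noncomputable def shellCharIntegral (c : ℚ_[2]) : ℕ → ℂ
  | 0 => if ‖c‖ ≤ 1 then 1 else 0
  | k + 1 => (if ‖c‖ ≤ (2 : ℝ) ^ (-((k + 1 : ℕ) : ℤ)) then (2 : ℂ) ^ (k + 1) else 0) -
      (if ‖c‖ ≤ (2 : ℝ) ^ (-(k : ℤ)) then (2 : ℂ) ^ k else 0)

lemma shellCharIntegral_eq_zero {c : ℚ_[2]} (hc : 1 < ‖c‖) (k : ℕ) :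
    shellCharIntegral c k = 0 := by
  have h : ∀ m : ℕ, ¬ ‖c‖ ≤ (2 : ℝ) ^ (-(m : ℤ)) := fun m =>
    not_le.2 ((zpow_le_one_of_nonpos₀ one_le_two (by lia)).trans_lt hc)
  cases k with
  | zero => simpa [shellCharIntegral] using hc
  | succ k => rw [shellCharIntegral, if_neg (h _), if_neg (h _), sub_zero]

lemma shellCharIntegral_zero {c : ℚ_[2]} {o : ℕ} (hc : ‖c‖ = (2 : ℝ) ^ (-(o : ℤ))) :
    shellCharIntegral c 0 = 1 := by
  rw [shellCharIntegral, if_pos]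
  rw [hc]
  exact zpow_le_one_of_nonpos₀ one_le_two (by lia)

lemma shellCharIntegral_succ {c : ℚ_[2]} {o : ℕ} (hc : ‖c‖ = (2 : ℝ) ^ (-(o : ℤ))) (k : ℕ) :
    shellCharIntegral c (k + 1) = if k < o then 2 ^ k else if k = o then -2 ^ k else 0 := by
  have h : ∀ m : ℕ, ‖c‖ ≤ (2 : ℝ) ^ (-(m : ℤ)) ↔ m ≤ o := by
    intro m
    rw [hc, zpow_le_zpow_iff_right₀ one_lt_two]
    lia
  simp only [shellCharIntegral, h]
  split_ifs <;> first | lia | ring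

lemma sum_range_shell {c : ℚ_[2]} {o : ℕ} (hc : ‖c‖ = (2 : ℝ) ^ (-(o : ℤ))) (q : ℂ) {m : ℕ}
    (hm : 1 ≤ m) (hmo : m ≤ o) :
    ∑ k ∈ Finset.range (m + 1), shellCoeff k * q ^ k * shellCharIntegral c k =
      1 / 2 - q / 2 + (∑ n ∈ Finset.Icc 1 m, q ^ n) / 2 := by
  induction m, hm using Nat.le_induction with
  | base => simp [Finset.sum_range_succ, shellCoeff, shellCharIntegral_zero hc]
  | succ m hm ih =>
    rw [Finset.sum_range_succ, ih (by lia), Finset.sum_Icc_succ_top (by lia),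
      shellCharIntegral_succ hc, if_pos (by lia), shellCoeff, if_neg (by lia), if_neg (by lia)]
    have : (1 / 2 : ℂ) ^ (m + 1) * 2 ^ m = 1 / 2 := by
      rw [pow_succ, mul_right_comm, ← mul_pow]
      norm_num
    linear_combination q ^ (m + 1) * this

lemma mul_sum_Icc_pow (q : ℂ) (m : ℕ) :
    q * ∑ n ∈ Finset.Icc 1 m, q ^ n = (∑ n ∈ Finset.Icc 1 m, q ^ n) + q ^ (m + 1) - q := by
  induction m with
  | zero => simp
  | succ m ih => rw [Finset.sum_Icc_succ_top (by lia), mul_add, ih]; ring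

lemma hasSum_shell {c : ℚ_[2]} {o : ℕ} (hc : ‖c‖ = (2 : ℝ) ^ (-(o : ℤ))) (q : ℂ) :
    HasSum (fun k => shellCoeff k * q ^ k * shellCharIntegral c k)
      (if o = 0 then 1 / 2 else 1 / 2 - q + (1 - q / 2) * ∑ n ∈ Finset.Icc 1 o, q ^ n) := by
  have h := hasSum_sum_of_ne_finset_zero (L := .unconditional ℕ)
    (f := fun k => shellCoeff k * q ^ k * shellCharIntegral c k)
    (s := Finset.range (o + 2)) (by
      intro k hk
      rw [Finset.mem_range, not_lt] at hk
      obtain ⟨j, rfl⟩ := Nat.exists_eq_add_of_le' (show 1 ≤ k by lia)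
      rw [shellCharIntegral_succ hc, if_neg (by lia), if_neg (by lia), mul_zero])
  refine (congrArg (HasSum _ · _) ?_).mp h
  split_ifs with ho
  · subst ho
    simp [Finset.sum_range_succ, shellCoeff, shellCharIntegral_zero hc]
  · rw [Finset.sum_range_succ, sum_range_shell hc q (by lia) le_rfl, shellCharIntegral_succ hc,
      if_neg (by lia), if_pos rfl, shellCoeff, if_neg (by lia), if_neg (by lia)]
    have : (1 / 2 : ℂ) ^ (o + 1) * 2 ^ o = 1 / 2 := by
      rw [pow_succ, mul_right_comm, ← mul_pow]
      norm_num
    linear_combination mul_sum_Icc_pow q o / 2 - q ^ (o + 1) * this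

section Measure

variable [MeasurableSpace ℚ_[2]] [BorelSpace ℚ_[2]] (μ : Measure ℚ_[2]) [μ.IsAddHaarMeasure]

lemma measureReal_closedBall_center (x : ℚ_[2]) (r : ℝ) :
    μ.real (closedBall x r) = μ.real (closedBall 0 r) := by
  rw [measureReal_def, measureReal_def, ← measure_preimage_add μ x (closedBall x r)]
  congr 2
  ext y
  simp [dist_eq_norm]

lemma measureReal_closedBall_succ (n : ℤ) :
    μ.real (closedBall (0 : ℚ_[2]) (2 ^ (n + 1))) = 2 * μ.real (closedBall (0 : ℚ_[2]) (2 ^ n)) := by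
  have hc : ‖(2 : ℚ_[2]) ^ (-(n + 1))‖ = (2 : ℝ) ^ (n + 1) := by rw [norm_two_zpow, neg_neg]
  have hlt : (2 : ℝ) ^ n < (2 : ℝ) ^ (n + 1) := zpow_lt_zpow_right₀ one_lt_two (by lia)
  have hU : closedBall (0 : ℚ_[2]) (2 ^ (n + 1)) =
      closedBall 0 (2 ^ n) ∪ closedBall (2 ^ (-(n + 1))) (2 ^ n) := by
    ext x
    simp only [Set.mem_union, mem_closedBall, dist_eq_norm, sub_zero]
    constructor
    · intro hx
      rcases hx.lt_or_eq with h | h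
      · exact Or.inl ((norm_le_two_zpow_iff_lt x n).2 h)
      · exact Or.inr (norm_sub_le_of_norm_eq h hc)
    · rintro (h | h)
      · exact h.trans hlt.le
      · have := IsUltrametricDist.norm_add_le_max (x - 2 ^ (-(n + 1))) ((2 : ℚ_[2]) ^ (-(n + 1)))
        rw [sub_add_cancel, hc] at this
        exact this.trans (max_le (h.trans hlt.le) le_rfl)
  have hd : Disjoint (closedBall (0 : ℚ_[2]) (2 ^ n)) (closedBall (2 ^ (-(n + 1))) (2 ^ n)) := by
    rw [Set.disjoint_left]
    intro x h1 h2
    simp only [mem_closedBall, dist_eq_norm, sub_zero] at h1 h2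
    have := IsUltrametricDist.norm_add_le_max (x) (-(x - (2 : ℚ_[2]) ^ (-(n + 1))))
    rw [norm_neg, show x + -(x - (2 : ℚ_[2]) ^ (-(n + 1))) = 2 ^ (-(n + 1)) by ring, hc] at this
    exact absurd (this.trans (max_le h1 h2)) (not_le.2 hlt)
  rw [hU, measureReal_union hd measurableSet_closedBall
    (isCompact_closedBall _ _).measure_lt_top.ne (isCompact_closedBall _ _).measure_lt_top.ne,
    measureReal_closedBall_center μ (2 ^ (-(n + 1)))]
  ring

variable {μ}

lemma measureReal_closedBall (hμ : μ {x : ℚ_[2] | ‖x‖ ≤ 1} = 1) (x : ℚ_[2]) (n : ℤ) :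
    μ.real (closedBall x (2 ^ n)) = (2 : ℝ) ^ n := by
  rw [measureReal_closedBall_center]
  have h0 : μ.real (closedBall (0 : ℚ_[2]) (2 ^ (0 : ℤ))) = 1 := by
    have : closedBall (0 : ℚ_[2]) (2 ^ (0 : ℤ)) = {x : ℚ_[2] | ‖x‖ ≤ 1} := by ext; simp
    rw [this, measureReal_def, hμ, ENNReal.toReal_one]
  induction n with
  | zero => simpa using h0
  | succ k ih => rw [measureReal_closedBall_succ, ih, zpow_add_one₀ two_ne_zero, mul_comm]
  | pred k ih =>
    have h := measureReal_closedBall_succ μ (-(k : ℤ) - 1)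
    rw [sub_add_cancel, ih] at h
    have h2 := zpow_sub_one₀ (two_ne_zero (α := ℝ)) (-(k : ℤ))
    linarith

lemma setIntegral_addChar_closedBall (hμ : μ {x : ℚ_[2] | ‖x‖ ≤ 1} = 1)
    (hψadd : ∀ x y : ℚ_[2], ψ (x + y) = ψ x * ψ y)
    (hψtriv : ∀ x : ℚ_[2], ‖x‖ ≤ 1 → ψ x = 1) (hψhalf : ψ (2⁻¹ : ℚ_[2]) = -1)
    (c : ℚ_[2]) (n : ℤ) :
    ∫ x in closedBall (0 : ℚ_[2]) (2 ^ n), ψ (c * x) ∂μ =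
      if ‖c‖ ≤ (2 : ℝ) ^ (-n) then (2 : ℂ) ^ n else 0 := by
  split_ifs with h
  · rw [setIntegral_congr_fun (g := fun _ => (1 : ℂ)) measurableSet_closedBall]
    · rw [setIntegral_const, measureReal_closedBall hμ]
      simp
    · intro x hx
      apply hψtriv
      rw [mem_closedBall, dist_zero_right] at hx
      calc ‖c * x‖ = ‖c‖ * ‖x‖ := norm_mul _ _
        _ ≤ 2 ^ (-n) * 2 ^ n := by gcongr
        _ = 1 := by rw [← zpow_add₀ two_ne_zero]; simp
  · have hc : c ≠ 0 := by
      rintro rfl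
      exact h (by rw [norm_zero]; positivity)
    obtain ⟨k, hk⟩ := exists_norm_eq_two_zpow hc
    rw [hk, zpow_le_zpow_iff_right₀ one_lt_two, not_le] at h
    set y : ℚ_[2] := 2⁻¹ / c with hy
    have hcy : c * y = 2⁻¹ := by rw [hy]; field_simp
    have hyn : ‖y‖ ≤ (2 : ℝ) ^ n := by
      have h2 : ‖(2⁻¹ : ℚ_[2])‖ = 2 := by simpa using norm_two_zpow (-1)
      rw [hy, norm_div, h2, hk]
      calc (2 : ℝ) / 2 ^ k = 2 ^ (1 - k) := by rw [zpow_sub₀ two_ne_zero, zpow_one]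
        _ ≤ 2 ^ n := zpow_le_zpow_right₀ one_le_two (by lia)
    have hshift : ∀ x, x + y ∈ closedBall (0 : ℚ_[2]) (2 ^ n) ↔ x ∈ closedBall (0 : ℚ_[2]) (2 ^ n) := by
      intro x
      simp only [mem_closedBall, dist_zero_right]
      constructor
      · intro hx
        have := IsUltrametricDist.norm_add_le_max (x + y) (-y)
        rw [norm_neg, add_neg_cancel_right] at this
        exact this.trans (max_le hx hyn)
      · intro hx
        exact (IsUltrametricDist.norm_add_le_max x y).trans (max_le hx hyn)
    have key : ∫ x in closedBall (0 : ℚ_[2]) (2 ^ n), ψ (c * x) ∂μ =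
        -∫ x in closedBall (0 : ℚ_[2]) (2 ^ n), ψ (c * x) ∂μ := by
      rw [← integral_neg, ← integral_indicator measurableSet_closedBall,
        ← integral_add_right_eq_self _ y, ← integral_indicator measurableSet_closedBall]
      congr 1
      ext x
      by_cases hx : x ∈ closedBall (0 : ℚ_[2]) (2 ^ n)
      · rw [Set.indicator_of_mem ((hshift x).2 hx), Set.indicator_of_mem hx, mul_add, hψadd, hcy,
          hψhalf, mul_neg_one]
      · rw [Set.indicator_of_notMem (mt (hshift x).1 hx), Set.indicator_of_notMem hx]
    exact CharZero.eq_neg_self_iff.1 key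

lemma setIntegral_closedBall_one (f : ℚ_[2] → ℂ) (r : ℝ) :
    ∫ y in closedBall (1 : ℚ_[2]) r, f y ∂μ = ∫ y in closedBall (0 : ℚ_[2]) r, f (y + 1) ∂μ := by
  rw [← integral_indicator measurableSet_closedBall, ← integral_add_right_eq_self _ 1,
    ← integral_indicator measurableSet_closedBall]
  congr 1
  ext x
  simp [Set.indicator, dist_eq_norm]

lemma setIntegral_Mset_zero [SigmaFinite μ] (hψcont : Continuous ψ)
    (hψadd : ∀ x y : ℚ_[2], ψ (x + y) = ψ x * ψ y) (b : ℚ_[2]) :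
    ∫ p in Mset 0, ψ (b * p.1 * p.2) ∂(μ.prod μ) =
      (∫ x in closedBall (0 : ℚ_[2]) (2 ^ (-1 : ℤ)),
        ∫ y in closedBall (0 : ℚ_[2]) (2 ^ (-1 : ℤ)), ψ (b * x * y) ∂μ ∂μ) +
      ∫ x in closedBall (1 : ℚ_[2]) (2 ^ (-1 : ℤ)),
        ψ (b * x) * ∫ y in closedBall (0 : ℚ_[2]) (2 ^ (-1 : ℤ)), ψ (b * x * y) ∂μ ∂μ := by
  have hint : ∀ z w : ℚ_[2], IntegrableOn (fun p : ℚ_[2] × ℚ_[2] => ψ (b * p.1 * p.2))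
      (closedBall z (2 ^ (-1 : ℤ)) ×ˢ closedBall w (2 ^ (-1 : ℤ))) (μ.prod μ) := fun z w =>
    ContinuousOn.integrableOn_compact ((isCompact_closedBall _ _).prod (isCompact_closedBall _ _))
      (by fun_prop)
  rw [Mset_zero_eq, setIntegral_union _ (measurableSet_closedBall.prod measurableSet_closedBall)
    (hint 0 0) (hint 1 1), setIntegral_prod _ (hint 0 0), setIntegral_prod _ (hint 1 1)]
  · congr 2
    ext x
    rw [setIntegral_closedBall_one, ← integral_const_mul]
    congr 1
    ext y
    rw [mul_add, mul_one, add_comm, hψadd]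
  · rw [Set.disjoint_left]
    rintro ⟨x, y⟩ ⟨h1, -⟩ ⟨h2, -⟩
    simp only [mem_closedBall, dist_eq_norm, sub_zero] at h1 h2
    rw [norm_eq_one_of_norm_sub_one_le h2] at h1
    exact absurd h1 (by norm_num)

lemma setIntegral_Mset_zero_eq_shellCoeff [SigmaFinite μ] (hμ : μ {x : ℚ_[2] | ‖x‖ ≤ 1} = 1)
    (hψcont : Continuous ψ) (hψadd : ∀ x y : ℚ_[2], ψ (x + y) = ψ x * ψ y)
    (hψtriv : ∀ x : ℚ_[2], ‖x‖ ≤ 1 → ψ x = 1) (hψhalf : ψ (2⁻¹ : ℚ_[2]) = -1)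
    {b : ℚ_[2]} {k : ℕ} (hb : max 1 ‖b‖ = 2 ^ k) :
    ∫ p in Mset 0, ψ (b * p.1 * p.2) ∂(μ.prod μ) = shellCoeff k := by
  have hinner := fun x => setIntegral_addChar_closedBall hμ hψadd hψtriv hψhalf (b * x) (-1)
  have hunit : ∀ x ∈ closedBall (1 : ℚ_[2]) (2 ^ (-1 : ℤ)), ‖x‖ = 1 := fun x hx =>
    norm_eq_one_of_norm_sub_one_le (by rwa [mem_closedBall, dist_eq_norm] at hx)
  rw [setIntegral_Mset_zero hψcont hψadd]
  simp only [hinner, neg_neg, zpow_one, norm_mul]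
  have hvol := fun x => measureReal_closedBall hμ x (-1)
  have hodd : (∫ x in closedBall (1 : ℚ_[2]) (2 ^ (-1 : ℤ)),
      ψ (b * x) * (if ‖b‖ * ‖x‖ ≤ 2 then (2 : ℂ) ^ (-1 : ℤ) else 0) ∂μ) =
      if k = 0 then 1 / 4 else if k = 1 then -1 / 4 else 0 := by
    have hval : ∀ x ∈ closedBall (1 : ℚ_[2]) (2 ^ (-1 : ℤ)),
        ψ (b * x) * (if ‖b‖ * ‖x‖ ≤ 2 then (2 : ℂ) ^ (-1 : ℤ) else 0) =
          if k = 0 then 1 / 2 else if k = 1 then -1 / 2 else 0 := by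
      intro x hx
      have hbx : ‖b * x‖ = ‖b‖ := by rw [norm_mul, hunit x hx, mul_one]
      rw [hunit x hx, mul_one]
      split_ifs with h1 h2 h3 h3 h4
      · subst h2
        rw [hψtriv _ (by rw [hbx, ← pow_zero (2 : ℝ), ← hb]; exact le_max_right _ _)]
        norm_num
      · subst h3
        rw [addChar_eq_neg_one hψadd hψtriv hψhalf]
        · norm_num
        · rw [hbx]
          rcases max_choice 1 ‖b‖ with h | h <;> rw [h] at hb <;> norm_num at hb
          exact hb
      · exfalso
        have : (2 : ℝ) ^ 2 ≤ 2 ^ k := pow_le_pow_right₀ one_le_two (by lia)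
        rw [← hb] at this
        rcases le_max_iff.1 this with h | h <;> linarith
      · subst h3
        rw [pow_zero] at hb
        exact absurd ((le_max_right _ _).trans hb.le) (by linarith)
      · subst h4
        rw [pow_one] at hb
        exact absurd ((le_max_right _ _).trans hb.le) (by linarith)
      · simp
    rw [setIntegral_congr_fun measurableSet_closedBall hval, setIntegral_const, hvol]
    split_ifs <;> norm_num
  have heven : (∫ x in closedBall (0 : ℚ_[2]) (2 ^ (-1 : ℤ)),
      (if ‖b‖ * ‖x‖ ≤ 2 then (2 : ℂ) ^ (-1 : ℤ) else 0) ∂μ) =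
      if k ≤ 1 then 1 / 4 else (1 / 2) ^ k := by
    split_ifs with hk
    · have hb2 : ‖b‖ ≤ 2 := (le_max_right 1 _).trans
        (hb.le.trans (by simpa using pow_le_pow_right₀ (one_le_two (α := ℝ)) hk))
      rw [setIntegral_congr_fun (g := fun _ => (1 / 2 : ℂ)) measurableSet_closedBall,
        setIntegral_const, hvol]
      · norm_num
      · intro x hx
        rw [mem_closedBall, dist_zero_right] at hx
        have h1 : ‖x‖ ≤ 1 := hx.trans (by norm_num)
        have : ‖b‖ * ‖x‖ ≤ 2 := by nlinarith [norm_nonneg b, norm_nonneg x]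
        simp only [this, if_true]
        norm_num
    · have hbk : ‖b‖ = 2 ^ k := by
        rcases max_choice 1 ‖b‖ with h | h
        · rw [h] at hb
          exact absurd hb (one_lt_pow₀ one_lt_two (by lia)).ne
        · rw [← h, hb]
      have hset : closedBall (0 : ℚ_[2]) (2 ^ (-1 : ℤ)) ∩ closedBall 0 (2 ^ (1 - k : ℤ)) =
          closedBall 0 (2 ^ (1 - k : ℤ)) := by
        rw [Set.inter_eq_right]
        exact closedBall_subset_closedBall (zpow_le_zpow_right₀ one_le_two (by lia))
      have hind : (fun x : ℚ_[2] => if ‖b‖ * ‖x‖ ≤ 2 then (2 : ℂ) ^ (-1 : ℤ) else 0) =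
          (closedBall (0 : ℚ_[2]) (2 ^ (1 - k : ℤ))).indicator fun _ => (2 : ℂ) ^ (-1 : ℤ) := by
        ext x
        have : ‖b‖ * ‖x‖ ≤ 2 ↔ x ∈ closedBall (0 : ℚ_[2]) (2 ^ (1 - k : ℤ)) := by
          rw [mem_closedBall, dist_zero_right, hbk, zpow_sub₀ two_ne_zero, zpow_one, zpow_natCast,
            le_div_iff₀' (by positivity)]
        by_cases h : ‖b‖ * ‖x‖ ≤ 2
        · rw [if_pos h, Set.indicator_of_mem (this.1 h)]
        · rw [if_neg h, Set.indicator_of_notMem (mt this.2 h)]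
      rw [hind, setIntegral_indicator measurableSet_closedBall, hset, setIntegral_const,
        measureReal_closedBall hμ, zpow_sub₀ two_ne_zero]
      simp
      ring
  rw [hodd, heven, shellCoeff]
  rcases k with _ | _ | k <;> norm_num

lemma measurableSet_shell (k : ℕ) : MeasurableSet (shell k) := by
  cases k with
  | zero => rw [shell_zero]; exact measurableSet_closedBall
  | succ k => rw [shell_succ]; exact measurableSet_closedBall.diff measurableSet_closedBall

lemma setIntegral_addChar_shell (hμ : μ {x : ℚ_[2] | ‖x‖ ≤ 1} = 1) (hψcont : Continuous ψ)
    (hψadd : ∀ x y : ℚ_[2], ψ (x + y) = ψ x * ψ y)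
    (hψtriv : ∀ x : ℚ_[2], ‖x‖ ≤ 1 → ψ x = 1) (hψhalf : ψ (2⁻¹ : ℚ_[2]) = -1)
    (c : ℚ_[2]) (k : ℕ) : ∫ x in shell k, ψ (c * x) ∂μ = shellCharIntegral c k := by
  have hball := setIntegral_addChar_closedBall hμ hψadd hψtriv hψhalf c
  cases k with
  | zero =>
    rw [shell_zero, hball]
    simp [shellCharIntegral]
  | succ k =>
    rw [shell_succ, setIntegral_sdiff measurableSet_closedBall, hball, hball]
    · simp only [shellCharIntegral, zpow_natCast]
    · exact ContinuousOn.integrableOn_compact (isCompact_closedBall _ _) (by fun_prop)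
    · exact closedBall_subset_closedBall (zpow_le_zpow_right₀ one_le_two (by lia))

lemma integrable_and_hasSum_whittaker [SigmaFinite μ] (hμ : μ {x : ℚ_[2] | ‖x‖ ≤ 1} = 1)
    (hψcont : Continuous ψ) (hψadd : ∀ x y : ℚ_[2], ψ (x + y) = ψ x * ψ y)
    (hψtriv : ∀ x : ℚ_[2], ‖x‖ ≤ 1 → ψ x = 1) (hψhalf : ψ (2⁻¹ : ℚ_[2]) = -1)
    {s : ℝ} (hs : 0 < s) (t : ℚ_[2]) :
    Integrable (fun b : ℚ_[2] =>
      (∫ p in Mset 0, ψ (b * p.1 * p.2) ∂(μ.prod μ)) * ψ (-(t * b))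
        * (((min 1 ‖b‖⁻¹) ^ s : ℝ) : ℂ)) μ ∧
    HasSum (fun k : ℕ =>
        shellCoeff k * (((2 : ℝ) ^ (-s) : ℝ) : ℂ) ^ k * shellCharIntegral (-t) k)
      (∫ b : ℚ_[2], (∫ p in Mset 0, ψ (b * p.1 * p.2) ∂(μ.prod μ)) * ψ (-(t * b))
        * (((min 1 ‖b‖⁻¹) ^ s : ℝ) : ℂ) ∂μ) := by
  set q : ℝ := (2 : ℝ) ^ (-s) with hq
  have hq0 : 0 < q := by positivity
  have hq1 : q < 1 := Real.rpow_lt_one_of_one_lt_of_neg one_lt_two (by linarith)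
  set F : ℚ_[2] → ℂ := fun b =>
    (∫ p in Mset 0, ψ (b * p.1 * p.2) ∂(μ.prod μ)) * ψ (-(t * b))
      * (((min 1 ‖b‖⁻¹) ^ s : ℝ) : ℂ) with hF
  set G : ℕ → ℚ_[2] → ℂ := fun k b => shellCoeff k * (q : ℂ) ^ k * ψ (-t * b) with hG
  have hFG : ∀ k, ∀ b ∈ shell k, b ≠ 0 → F b = G k b := by
    intro k b hb hb0
    have hmin : min 1 ‖b‖⁻¹ = (2 ^ k)⁻¹ := by
      rw [← show max 1 ‖b‖ = 2 ^ k from hb]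
      have hb' := norm_pos_iff.2 hb0
      rcases le_total ‖b‖ 1 with h | h
      · rw [max_eq_left h, inv_one, min_eq_left ((one_le_inv₀ hb').2 h)]
      · rw [max_eq_right h, min_eq_right (inv_le_one_of_one_le₀ h)]
    have hpow : ((2 ^ k)⁻¹ : ℝ) ^ s = q ^ k := by
      rw [Real.inv_rpow (by positivity), ← Real.rpow_neg (by positivity), hq,
        ← Real.rpow_natCast 2 k, ← Real.rpow_mul two_pos.le, mul_comm,
        Real.rpow_mul two_pos.le, Real.rpow_natCast]
    simp only [hF, hG]
    rw [setIntegral_Mset_zero_eq_shellCoeff hμ hψcont hψadd hψtriv hψhalf hb, hmin, hpow,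
      Complex.ofReal_pow, neg_mul]
    ring
  have hae : ∀ k, F =ᵐ[μ.restrict (shell k)] G k := by
    intro k
    have h0 : ∀ᵐ b ∂μ, b ≠ 0 := by simp [ae_iff]
    filter_upwards [ae_restrict_mem (measurableSet_shell k), ae_restrict_of_ae h0] with b h1 h2
    exact hFG k b h1 h2
  have hGint : ∀ k, IntegrableOn (G k) (shell k) μ := fun k =>
    (ContinuousOn.integrableOn_compact (isCompact_closedBall _ _)
      (by simp only [hG]; fun_prop)).mono_set (shell_subset k)
  have hFint : ∀ k, IntegrableOn F (shell k) μ := fun k => (hGint k).congr (hae k).symm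
  have hnorm : ∀ k, ∫ b in shell k, ‖F b‖ ∂μ ≤ q ^ k := by
    intro k
    have hval : ∀ b, ‖G k b‖ = ‖shellCoeff k‖ * q ^ k := by
      intro b
      simp only [hG, norm_mul, norm_addChar_eq_one hψadd hψtriv, norm_pow, Complex.norm_real,
        Real.norm_of_nonneg hq0.le, mul_one]
    have hae' : (fun b => ‖F b‖) =ᵐ[μ.restrict (shell k)] fun _ => ‖shellCoeff k‖ * q ^ k := by
      filter_upwards [hae k] with b hb
      rw [hb, hval]
    rw [integral_congr_ae hae', setIntegral_const, smul_eq_mul]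
    have hvol : μ.real (shell k) ≤ 2 ^ k := by
      rw [← zpow_natCast, ← measureReal_closedBall hμ 0 k]
      exact measureReal_mono (shell_subset k) (isCompact_closedBall _ _).measure_lt_top.ne
    calc μ.real (shell k) * (‖shellCoeff k‖ * q ^ k)
        ≤ 2 ^ k * (‖shellCoeff k‖ * q ^ k) := by gcongr
      _ = ‖shellCoeff k‖ * 2 ^ k * q ^ k := by ring
      _ ≤ 1 * q ^ k := by gcongr; exact norm_shellCoeff_mul_le k
      _ = q ^ k := one_mul _
  have hFunion : IntegrableOn F (⋃ k, shell k) μ :=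
    integrableOn_iUnion_of_summable_integral_norm hFint
      (Summable.of_nonneg_of_le (fun k => integral_nonneg fun b => norm_nonneg _) hnorm
        (summable_geometric_of_lt_one hq0.le hq1))
  have hsum := hasSum_integral_iUnion measurableSet_shell pairwise_disjoint_shell hFunion
  rw [iUnion_shell] at hsum hFunion
  refine ⟨integrableOn_univ.1 hFunion, ?_⟩
  rw [setIntegral_univ] at hsum
  refine hsum.congr_fun fun k => ?_
  rw [integral_congr_ae (hae k)]
  simp only [hG]
  rw [integral_const_mul, setIntegral_addChar_shell hμ hψcont hψadd hψtriv hψhalf]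

end Measure

end Padic

/-- **Paper, Lemma 5.5(1).** The normalized local Whittaker function
`I₀(s,t) = ∫_{ℚ₂} J₀(b) ψ(-tb) min(1,‖b‖⁻¹)^s dμ(b)` (with
`J₀(b) = ∫_{M₀} ψ(b x₁ x₂) d(μ×μ)`) converges absolutely for `s > 0` and `t ≠ 0`, and
equals `0` if `‖t‖ > 1`, `1/2` if `‖t‖ = 1`, and
`1/2 - 2^{-s} + (1 - 2^{-1-s}) Σ_{n=1}^{o} 2^{-ns}` if `‖t‖ = 2^{-o}` with `o ≥ 1`. -/
theorem stmt14 [MeasurableSpace ℚ_[2]] [BorelSpace ℚ_[2]]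
    (μ : Measure ℚ_[2]) [μ.IsAddHaarMeasure] [SigmaFinite μ]
    (hμ : μ {x : ℚ_[2] | ‖x‖ ≤ 1} = 1)
    (ψ : ℚ_[2] → ℂ) (hψcont : Continuous ψ)
    (hψadd : ∀ x y : ℚ_[2], ψ (x + y) = ψ x * ψ y)
    (hψtriv : ∀ x : ℚ_[2], ‖x‖ ≤ 1 → ψ x = 1)
    (hψhalf : ψ (2⁻¹ : ℚ_[2]) = -1)
    (s : ℝ) (hs : 0 < s) (t : ℚ_[2]) (ht : t ≠ 0) :
    Integrable
      (fun b : ℚ_[2] =>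
        (∫ p in Mset 0, ψ (b * p.1 * p.2) ∂(μ.prod μ)) * ψ (-(t * b))
          * (((min 1 ‖b‖⁻¹) ^ s : ℝ) : ℂ)) μ ∧
    (1 < ‖t‖ →
      (∫ b : ℚ_[2],
        (∫ p in Mset 0, ψ (b * p.1 * p.2) ∂(μ.prod μ)) * ψ (-(t * b))
          * (((min 1 ‖b‖⁻¹) ^ s : ℝ) : ℂ) ∂μ) = 0) ∧
    (‖t‖ = 1 →
      (∫ b : ℚ_[2],
        (∫ p in Mset 0, ψ (b * p.1 * p.2) ∂(μ.prod μ)) * ψ (-(t * b))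
          * (((min 1 ‖b‖⁻¹) ^ s : ℝ) : ℂ) ∂μ) = (1 / 2 : ℂ)) ∧
    (∀ o : ℕ, 1 ≤ o → ‖t‖ = (2 : ℝ) ^ (-(o : ℤ)) →
      (∫ b : ℚ_[2],
        (∫ p in Mset 0, ψ (b * p.1 * p.2) ∂(μ.prod μ)) * ψ (-(t * b))
          * (((min 1 ‖b‖⁻¹) ^ s : ℝ) : ℂ) ∂μ)
        = (1 / 2 : ℂ) - (((2 : ℝ) ^ (-s) : ℝ) : ℂ)
            + (1 - (((2 : ℝ) ^ (-1 - s) : ℝ) : ℂ))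
              * ∑ n ∈ Finset.Icc 1 o, (((2 : ℝ) ^ (-(n : ℝ) * s) : ℝ) : ℂ)) := by
  obtain ⟨hint, hsum⟩ := integrable_and_hasSum_whittaker hμ hψcont hψadd hψtriv hψhalf hs t
  refine ⟨hint, fun h => ?_, fun h => ?_, fun o ho h => ?_⟩
  · refine hsum.unique ?_
    simp only [shellCharIntegral_eq_zero (c := -t) (by rwa [norm_neg]), mul_zero]
    exact hasSum_zero
  · exact hsum.unique (hasSum_shell (o := 0) (by simpa using h) _)
  · rw [hsum.unique (hasSum_shell (o := o) (by rwa [norm_neg]) _), if_neg (by lia)]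
    have h1 : (2 : ℝ) ^ (-1 - s) = 2 ^ (-s) / 2 := by
      rw [show -1 - s = -s - 1 by ring, Real.rpow_sub_one two_ne_zero]
    have h2 : ∀ n : ℕ, (2 : ℝ) ^ (-(n : ℝ) * s) = (2 ^ (-s)) ^ n := by
      intro n
      rw [← Real.rpow_mul_natCast two_pos.le]
      congr 1
      ring
    simp only [h1, h2, Complex.ofReal_pow, Complex.ofReal_div, Complex.ofReal_ofNat]
end
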